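/- Strong minimum principle on a ball (Lemma 3.2): Let B_R(x₀) ⊂ ℝⁿ, let c ∈ C(closure(B_R(x₀))) with c ≤ 0, and let u ∈ W^{s,G}_loc(B_R(x₀)) ∩ L^g_s(ℝⁿ) ∩ C(closure(B_R(x₀))) be a weak supersolution of 𝓛u = c(x)g(|u|)u/|u| in B_R(x₀). If u ≥ 0 in ℝⁿ∖B_R(x₀), then either u(x) > 0 for every x ∈ B_R(x₀), or u = 0 a.e. in ℝⁿ. -/

import Mathlib

open MeasureTheory Metric Set Filter Topology Bornology
open scoped Classical

noncomputable section

/-- `n`-dimensional Euclidean space `ℝⁿ`. -/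
abbrev Eucl (n : ℕ) : Type := EuclideanSpace ℝ (Fin n)

/-- Condition (1.3) on `g` together with the structural assumptions:
`g : [0,∞) → [0,∞)` continuous, strictly increasing, convex, `g 0 = 0`,
`g t → ∞`, differentiable on `(0,∞)` with `p_g ≤ t g'(t)/g(t) ≤ q_g`,
extended oddly to all of `ℝ` by `g (-t) = - g t`. -/
structure CondG (g : ℝ → ℝ) (pg qg : ℝ) : Prop where
  one_lt : 1 < pg
  pg_le_qg : pg ≤ qg
  cont : ContinuousOn g (Ici 0)
  mono : StrictMonoOn g (Ici 0)
  convex : ConvexOn ℝ (Ici 0) g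
  zero : g 0 = 0
  infty : Tendsto g atTop atTop
  diff : ∀ t : ℝ, 0 < t → DifferentiableAt ℝ g t
  lower : ∀ t : ℝ, 0 < t → pg * g t ≤ t * deriv g t
  upper : ∀ t : ℝ, 0 < t → t * deriv g t ≤ qg * g t
  odd : ∀ t : ℝ, g (-t) = - g t

/-- Assumptions on the kernel `K`: symmetry, translation invariance,
the growth condition `λ |x-y|^{-n} ≤ K x y ≤ Λ |x-y|^{-n}` (off the diagonal)
and continuity off the diagonal. -/
structure CondK (n : ℕ) (K : Eucl n → Eucl n → ℝ) (lam Lam : ℝ) : Prop where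
  lam_pos : 0 < lam
  lam_le_Lam : lam ≤ Lam
  symm : ∀ x y, K x y = K y x
  transl : ∀ x y z, K (x + z) (y + z) = K x y
  lower : ∀ x y : Eucl n, x ≠ y → lam / ‖x - y‖ ^ n ≤ K x y
  upper : ∀ x y : Eucl n, x ≠ y → K x y ≤ Lam / ‖x - y‖ ^ n
  cont : ContinuousOn (fun p : Eucl n × Eucl n => K p.1 p.2) {p | p.1 ≠ p.2}

/-- The Young function `G(t) = ∫₀ᵗ g(θ) dθ`. -/
def GG (g : ℝ → ℝ) (t : ℝ) : ℝ := ∫ θ in (0:ℝ)..t, g θ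

/-- `u ∈ L^g_s(ℝⁿ)`. -/
def MemLgs (n : ℕ) (s : ℝ) (g : ℝ → ℝ) (u : Eucl n → ℝ) : Prop :=
  Measurable u ∧
    Integrable (fun x : Eucl n => g (|u x| / (1 + ‖x‖) ^ s) / (1 + ‖x‖) ^ ((n : ℝ) + s))

/-- `u ∈ W^{s,G}(U)`. -/
def MemWsG (n : ℕ) (s : ℝ) (g : ℝ → ℝ) (u : Eucl n → ℝ) (U : Set (Eucl n)) : Prop :=
  Measurable u ∧ IntegrableOn (fun x => GG g |u x|) U ∧
    IntegrableOn
      (fun p : Eucl n × Eucl n => GG g (|u p.1 - u p.2| / ‖p.1 - p.2‖ ^ s) / ‖p.1 - p.2‖ ^ n)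
      (U ×ˢ U)

/-- `u ∈ W^{s,G}_loc(Ω)`. -/
def MemWsGloc (n : ℕ) (s : ℝ) (g : ℝ → ℝ) (u : Eucl n → ℝ) (Ω : Set (Eucl n)) : Prop :=
  ∀ Ω' : Set (Eucl n), IsOpen Ω' → IsBounded Ω' → closure Ω' ⊆ Ω →
    ∃ U : Set (Eucl n), IsOpen U ∧ closure Ω' ⊆ U ∧ MemWsG n s g u U

/-- `η ∈ W^{s,G}₀(Ω)`. -/
def MemWsG0 (n : ℕ) (s : ℝ) (g : ℝ → ℝ) (Ω : Set (Eucl n)) (η : Eucl n → ℝ) : Prop :=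
  MemWsG n s g η univ ∧ ∀ x ∉ Ω, η x = 0

/-- The nonlocal energy pairing
`∬ g((u(x)-u(y))/|x-y|^s) (η(x)-η(y)) K(x,y) |x-y|^{-s} dx dy`
(with `g` oddly extended, so that
`g((u(x)-u(y))/|x-y|^s) = g(|u(x)-u(y)|/|x-y|^s)·sgn(u(x)-u(y))`). -/
def energy (n : ℕ) (s : ℝ) (g : ℝ → ℝ) (K : Eucl n → Eucl n → ℝ) (u η : Eucl n → ℝ) : ℝ :=
  ∫ p : Eucl n × Eucl n,
    g ((u p.1 - u p.2) / ‖p.1 - p.2‖ ^ s) * (η p.1 - η p.2) * K p.1 p.2 / ‖p.1 - p.2‖ ^ s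

/-- `η ∈ C_c^∞(Ω')`. -/
def IsTest (n : ℕ) (Ω' : Set (Eucl n)) (η : Eucl n → ℝ) : Prop :=
  ContDiff ℝ (⊤ : ℕ∞) η ∧ HasCompactSupport η ∧ tsupport η ⊆ Ω'

/-- `u` is a weak supersolution of `𝓛 u = c(x) g(|u|) u/|u|` in `Ω`
(by the odd extension the right-hand side integrand is `c(x) g(u(x)) η(x)`). -/
def WeakSupersol (n : ℕ) (s : ℝ) (g : ℝ → ℝ) (K : Eucl n → Eucl n → ℝ)
    (c : Eucl n → ℝ) (u : Eucl n → ℝ) (Ω : Set (Eucl n)) : Prop :=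
  MemWsGloc n s g u Ω ∧ MemLgs n s g u ∧
    ∀ Ω' : Set (Eucl n), IsOpen Ω' → IsBounded Ω' → Ω' ⊆ Ω →
      ∀ η : Eucl n → ℝ, IsTest n Ω' η → (∀ x, 0 ≤ η x) →
        (∫ x in Ω, c x * g (u x) * η x) ≤ energy n s g K u η

/-- `u` is a weak solution of `𝓛 u = f` in `Ω`. -/
def WeakSol (n : ℕ) (s : ℝ) (g : ℝ → ℝ) (K : Eucl n → Eucl n → ℝ)
    (f : Eucl n → ℝ) (u : Eucl n → ℝ) (Ω : Set (Eucl n)) : Prop :=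
  MemWsGloc n s g u Ω ∧ MemLgs n s g u ∧
    ∀ Ω' : Set (Eucl n), IsOpen Ω' → IsBounded Ω' → Ω' ⊆ Ω →
      ∀ η : Eucl n → ℝ, IsTest n Ω' η →
        energy n s g K u η = ∫ x in Ω, f x * η x

/-- `Lpv n s g K w x L` says that the principal value
`𝓛 w (x) = p.v. ∫ g((w(x)-w(y))/|x-y|^s) K(x,y) |x-y|^{-s} dy` exists and equals `L`. -/
def Lpv (n : ℕ) (s : ℝ) (g : ℝ → ℝ) (K : Eucl n → Eucl n → ℝ) (w : Eucl n → ℝ)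
    (x : Eucl n) (L : ℝ) : Prop :=
  Tendsto (fun ε : ℝ =>
      ∫ y in (ball x ε)ᶜ, g ((w x - w y) / ‖x - y‖ ^ s) * K x y / ‖x - y‖ ^ s)
    (𝓝[>] 0) (𝓝 L)

/-- The critical set `N_ψ` of `ψ` in `D`. -/
def CritSet (n : ℕ) (ψ : Eucl n → ℝ) (D : Set (Eucl n)) : Set (Eucl n) :=
  {x ∈ D | fderiv ℝ ψ x = 0}

/-- The class `C²_β(D)`. -/
def C2beta (n : ℕ) (ψ : Eucl n → ℝ) (D : Set (Eucl n)) (β : ℝ) : Prop :=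
  ContDiffOn ℝ 2 ψ D ∧
    ∃ M : ℝ, ∀ x ∈ D,
      (min (infDist x (CritSet n ψ D)) 1) ^ (β - 1) / ‖fderiv ℝ ψ x‖ +
          ‖iteratedFDeriv ℝ 2 ψ x‖ / (infDist x (CritSet n ψ D)) ^ (β - 2) ≤ M


section PartA
variable {g : ℝ → ℝ} {pg qg : ℝ}

lemma cg_nonneg (hg : CondG g pg qg) {t : ℝ} (ht : 0 ≤ t) : 0 ≤ g t := by
  have := hg.mono.monotoneOn (mem_Ici.2 le_rfl) (mem_Ici.2 ht) ht
  rwa [hg.zero] at this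

lemma cg_pos (hg : CondG g pg qg) {t : ℝ} (ht : 0 < t) : 0 < g t := by
  have := hg.mono (mem_Ici.2 le_rfl) (mem_Ici.2 ht.le) ht
  rwa [hg.zero] at this

lemma cg_mono (hg : CondG g pg qg) : Monotone g := by
  intro a b hab
  rcases le_total 0 a with ha | ha
  · exact hg.mono.monotoneOn (mem_Ici.2 ha) (mem_Ici.2 (ha.trans hab)) hab
  · have h1 : g a ≤ 0 := by
      have := cg_nonneg hg (t := -a) (by linarith)
      rw [hg.odd] at this; linarith
    rcases le_total 0 b with hb | hb
    · exact h1.trans (cg_nonneg hg hb)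
    · have := hg.mono.monotoneOn (mem_Ici.2 (show 0 ≤ -b by linarith))
        (mem_Ici.2 (show 0 ≤ -a by linarith)) (by linarith)
      rw [hg.odd, hg.odd] at this; linarith

lemma cg_cont (hg : CondG g pg qg) : Continuous g := by
  have e : g = fun t => if 0 ≤ t then g t else - g (-t) := by
    funext t
    split_ifs with h
    · rfl
    · rw [hg.odd]; ring
  rw [e]
  apply continuous_if_le continuous_const continuous_id
  · exact hg.cont
  · have : ContinuousOn (fun x : ℝ => - g (-x)) {x | x ≤ 0} := by
      apply ContinuousOn.neg
      apply hg.cont.comp continuousOn_neg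
      intro x hx
      simpa using hx
    exact this
  · intro x hx
    have : x = 0 := by simpa using hx.symm
    subst this; simp [hg.zero]

lemma cg_abs (hg : CondG g pg qg) (t : ℝ) : |g t| = g |t| := by
  rcases le_total 0 t with h | h
  · rw [abs_of_nonneg h, abs_of_nonneg (cg_nonneg hg h)]
  · rw [abs_of_nonpos h, hg.odd, abs_of_nonpos]
    have := cg_nonneg hg (t := -t) (by linarith)
    rw [hg.odd] at this; linarith

/-- scaling -/
lemma cg_scale (hg : CondG g pg qg) {c t : ℝ} (hc : 1 ≤ c) (ht : 0 ≤ t) :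
    g (c * t) ≤ c ^ qg * g t := by
  rcases ht.eq_or_lt with rfl | ht
  · simp [hg.zero]
  have hanti : AntitoneOn (fun x => g x * x ^ (-qg)) (Ioi 0) := by
    apply antitoneOn_of_deriv_nonpos (convex_Ioi 0)
    · apply ContinuousOn.mul (cg_cont hg).continuousOn
      intro x hx
      exact (Real.continuousAt_rpow_const _ _ (Or.inl (ne_of_gt hx))).continuousWithinAt
    · intro x hx
      rw [interior_Ioi] at hx
      exact ((hg.diff x hx).mul (Real.differentiableAt_rpow_const_of_ne _ (ne_of_gt hx))).differentiableWithinAt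
    · intro x hx
      rw [interior_Ioi] at hx
      have hx' : 0 < x := hx
      have h1 := (hg.diff x hx).hasDerivAt.mul (Real.hasDerivAt_rpow_const (p := -qg) (Or.inl (ne_of_gt hx)))
      have h2 := h1.deriv
      have h3 : x ^ (-qg) = x * x ^ (-qg - 1) := by
        rw [Real.rpow_sub_one (ne_of_gt hx)]; field_simp
      have h4 : deriv (fun x => g x * x ^ (-qg)) x = (x * deriv g x - qg * g x) * x ^ (-qg - 1) := by
        have : deriv (fun x => g x * x ^ (-qg)) x = _ := h2
        rw [this, h3]; ring
      rw [h4]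
      exact mul_nonpos_of_nonpos_of_nonneg (by linarith [hg.upper x hx]) (Real.rpow_nonneg hx'.le _)
  have hc0 : 0 < c := by linarith
  have h := hanti (mem_Ioi.2 ht) (mem_Ioi.2 (mul_pos hc0 ht)) (by nlinarith)
  simp only at h
  rw [Real.mul_rpow hc0.le ht.le, Real.rpow_neg hc0.le, Real.rpow_neg ht.le] at h
  have hcq := Real.rpow_pos_of_pos hc0 qg
  have htq := Real.rpow_pos_of_pos ht qg
  have e1 : g (c * t) * ((c ^ qg)⁻¹ * (t ^ qg)⁻¹) = g (c*t) / c ^ qg / t ^ qg := by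
    field_simp
  rw [e1, ← div_eq_mul_inv, div_le_div_iff_of_pos_right htq, div_le_iff₀ hcq] at h
  linarith

lemma cg_add (hg : CondG g pg qg) {a b : ℝ} (ha : 0 ≤ a) (hb : 0 ≤ b) :
    g (a + b) ≤ 2 ^ qg * (g a + g b) := by
  have h2 : (0:ℝ) < 2 ^ qg := by positivity
  rcases le_total a b with h | h
  · calc g (a + b) ≤ g (2 * b) := cg_mono hg (by linarith)
      _ ≤ 2 ^ qg * g b := cg_scale hg (by norm_num) hb
      _ ≤ _ := by have := cg_nonneg hg ha; gcongr; linarith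
  · calc g (a + b) ≤ g (2 * a) := cg_mono hg (by linarith)
      _ ≤ 2 ^ qg * g a := cg_scale hg (by norm_num) ha
      _ ≤ _ := by have := cg_nonneg hg hb; gcongr; linarith

/-- `H t = t g(t)` -/
def HH (g : ℝ → ℝ) (t : ℝ) : ℝ := t * g t

lemma HH_nonneg (hg : CondG g pg qg) (t : ℝ) : 0 ≤ HH g t := by
  unfold HH
  rcases le_total 0 t with h | h
  · exact mul_nonneg h (cg_nonneg hg h)
  · have := cg_mono hg h
    rw [hg.zero] at this
    nlinarith

lemma HH_abs (hg : CondG g pg qg) (t : ℝ) : HH g |t| = HH g t := by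
  unfold HH
  rcases le_total 0 t with h | h
  · rw [abs_of_nonneg h]
  · rw [abs_of_nonpos h, hg.odd]; ring

lemma HH_cont (hg : CondG g pg qg) : Continuous (HH g) := continuous_id.mul (cg_cont hg)

lemma HH_zero : HH g 0 = 0 := by simp [HH]

lemma HH_monoOn (hg : CondG g pg qg) : MonotoneOn (HH g) (Ici 0) := by
  intro a ha b hb hab
  exact mul_le_mul hab (cg_mono hg hab) (cg_nonneg hg ha) hb

lemma HH_le_of_abs (hg : CondG g pg qg) {a b : ℝ} (h : |a| ≤ b) : HH g a ≤ HH g b := by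
  rw [← HH_abs hg a]
  exact HH_monoOn hg (abs_nonneg a) ((abs_nonneg a).trans h) h

lemma HH_convex (hg : CondG g pg qg) : ConvexOn ℝ univ (HH g) := by
  have h1 : ConvexOn ℝ (Ici 0) (HH g) := by
    refine (convexOn_id (convex_Ici (0:ℝ))).mul hg.convex (fun x hx => hx)
      (fun x hx => cg_nonneg hg hx) ?_
    exact (monotoneOn_id).monovaryOn hg.mono.monotoneOn
  have e : HH g = (HH g) ∘ (fun t => |t|) := by
    funext t; exact (HH_abs hg t).symm
  rw [e]
  have him : (fun t : ℝ => |t|) '' univ ⊆ Ici 0 := by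
    rintro _ ⟨t, _, rfl⟩; exact abs_nonneg t
  have him' : (fun t : ℝ => |t|) '' univ = Ici 0 := by
    apply Subset.antisymm him
    intro x hx; exact ⟨x, trivial, abs_of_nonneg hx⟩
  apply ConvexOn.comp
  · rw [him']; exact h1
  · exact convexOn_norm convex_univ
  · rw [him']; exact HH_monoOn hg

lemma HH_add (hg : CondG g pg qg) (a b : ℝ) :
    HH g (a + b) ≤ 2 * 2 ^ qg * (HH g a + HH g b) := by
  have key : ∀ t, 0 ≤ t → HH g (2 * t) ≤ 2 * 2 ^ qg * HH g t := by
    intro t ht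
    unfold HH
    have := cg_scale hg (c := 2) (by norm_num) ht
    nlinarith
  have h2 : (0:ℝ) < 2 ^ qg := by positivity
  have ha := HH_nonneg hg a
  have hb := HH_nonneg hg b
  rcases le_total |a| |b| with h | h
  · calc HH g (a + b) ≤ HH g (2 * |b|) := HH_le_of_abs hg (by linarith [abs_add_le a b])
      _ ≤ 2 * 2 ^ qg * HH g |b| := key _ (abs_nonneg b)
      _ = 2 * 2 ^ qg * HH g b := by rw [HH_abs hg]
      _ ≤ _ := by gcongr; linarith
  · calc HH g (a + b) ≤ HH g (2 * |a|) := HH_le_of_abs hg (by linarith [abs_add_le a b])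
      _ ≤ 2 * 2 ^ qg * HH g |a| := key _ (abs_nonneg a)
      _ = 2 * 2 ^ qg * HH g a := by rw [HH_abs hg]
      _ ≤ _ := by gcongr; linarith

lemma HH_young (hg : CondG g pg qg) (a b : ℝ) : |g a * b| ≤ HH g a + HH g b := by
  rw [abs_mul, cg_abs hg, ← HH_abs hg a, ← HH_abs hg b]
  have ha := abs_nonneg a
  have hb := abs_nonneg b
  have h1 := cg_nonneg hg ha
  have h2 := cg_nonneg hg hb
  unfold HH
  rcases le_total |a| |b| with h | h
  · have := cg_mono hg h
    nlinarith
  · nlinarith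

lemma HH_le_GG (hg : CondG g pg qg) {t : ℝ} (ht : 0 ≤ t) :
    HH g t ≤ 2 * 2 ^ qg * GG g t := by
  have hi : ∀ a b : ℝ, IntervalIntegrable g volume a b := fun a b => (cg_cont hg).intervalIntegrable a b
  have h1 : GG g t = (∫ θ in (0:ℝ)..(t/2), g θ) + ∫ θ in (t/2)..t, g θ := by
    unfold GG; rw [intervalIntegral.integral_add_adjacent_intervals (hi _ _) (hi _ _)]
  have h2 : 0 ≤ ∫ θ in (0:ℝ)..(t/2), g θ :=
    intervalIntegral.integral_nonneg (by linarith) (fun x hx => cg_nonneg hg hx.1)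
  have h3 : (t/2) * g (t/2) ≤ ∫ θ in (t/2)..t, g θ := by
    have : ∫ θ in (t/2)..t, g (t/2) ≤ ∫ θ in (t/2)..t, g θ := by
      apply intervalIntegral.integral_mono_on (by linarith) (by simp) (hi _ _)
      intro x hx; exact cg_mono hg hx.1
    simp at this
    linarith
  have h4 := cg_scale hg (c := 2) (t := t/2) (by norm_num) (by linarith)
  have h5 : 2 * (t/2) = t := by ring
  rw [h5] at h4
  have h6 : (0:ℝ) < 2 ^ qg := by positivity
  unfold HH
  have h7 : t * g t ≤ t * (2 ^ qg * g (t/2)) := mul_le_mul_of_nonneg_left h4 ht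
  have h8 : (t/2) * g (t/2) ≤ GG g t := by linarith
  nlinarith

/-- local Lipschitz bound -/
lemma cg_lip (hg : CondG g pg qg) {T : ℝ} (hT : 0 < T) {a b : ℝ} (ha : |a| ≤ T) (hb : |b| ≤ T) :
    |g a - g b| ≤ g (2 * T) / T * |a - b| := by
  have hgT : 0 ≤ g (2*T) := cg_nonneg hg (by linarith)
  -- case both nonneg
  have key : ∀ x y, 0 ≤ x → x ≤ y → y ≤ T → g y - g x ≤ g (2 * T) / T * (y - x) := by
    intro x y hx hxy hy
    rcases hxy.eq_or_lt with rfl | hxy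
    · simp
    have h1 := hg.convex.slope_mono_adjacent (x := x) (y := y) (z := 2 * T) (mem_Ici.2 hx)
      (mem_Ici.2 (show (0:ℝ) ≤ 2 * T by linarith)) hxy (by linarith)
    have h2 : (g (2*T) - g y) / (2 * T - y) ≤ g (2*T) / T := by
      have : 0 ≤ g y := cg_nonneg hg (by linarith)
      apply div_le_div₀ hgT (by linarith) hT (by linarith)
    have h3 := h1.trans h2
    rwa [div_le_iff₀ (by linarith)] at h3
  have key2 : ∀ x y, x ≤ y → |x| ≤ T → |y| ≤ T → g y - g x ≤ g (2 * T) / T * (y - x) := by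
    intro x y hxy hx hy
    have hx' := abs_le.1 hx
    have hy' := abs_le.1 hy
    rcases le_total 0 x with h0 | h0
    · exact key x y h0 hxy hy'.2
    · rcases le_total 0 y with h1 | h1
      · have h2 := key 0 y le_rfl h1 hy'.2
        have h3 := key 0 (-x) le_rfl (by linarith) (by linarith)
        rw [hg.zero] at h2 h3
        rw [hg.odd] at h3
        linarith
      · have h3 := key (-y) (-x) (by linarith) (by linarith) (by linarith)
        rw [hg.odd, hg.odd] at h3
        linarith
  rcases le_total a b with h | h
  · rw [abs_sub_comm, abs_of_nonneg (by linarith [cg_mono hg h]), abs_sub_comm, abs_of_nonneg (by linarith)]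
    exact key2 a b h ha hb
  · rw [abs_of_nonneg (by linarith [cg_mono hg h]), abs_of_nonneg (by linarith)]
    exact key2 b a h hb ha

end PartA

section PartB
variable {n : ℕ} {s : ℝ} {g : ℝ → ℝ} {pg qg : ℝ}

/-- tail weight -/
def tailK (n : ℕ) (s d : ℝ) (z : Eucl n) : ℝ :=
  if d ≤ ‖z‖ then 1 / (‖z‖ ^ s * ‖z‖ ^ n) else 0

/-- near weight -/
def nearK (n : ℕ) (a : ℝ) (z : Eucl n) : ℝ :=
  if ‖z‖ ≤ 1 then ‖z‖ ^ a / ‖z‖ ^ n else 0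

lemma tailK_nonneg (d : ℝ) (z : Eucl n) : 0 ≤ tailK n s d z := by
  unfold tailK; split_ifs <;> positivity

lemma nearK_nonneg (d : ℝ) (z : Eucl n) : 0 ≤ nearK n d z := by
  unfold nearK; split_ifs <;> positivity

lemma tailK_neg (d : ℝ) (z : Eucl n) : tailK n s d (-z) = tailK n s d z := by
  unfold tailK; rw [norm_neg]

lemma nearK_neg (d : ℝ) (z : Eucl n) : nearK n d (-z) = nearK n d z := by
  unfold nearK; rw [norm_neg]

lemma tailK_meas (d : ℝ) : Measurable (tailK n s d) := by
  unfold tailK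
  refine Measurable.ite (measurableSet_le measurable_const measurable_norm) ?_ measurable_const
  fun_prop

lemma nearK_meas (d : ℝ) : Measurable (nearK n d) := by
  unfold nearK
  refine Measurable.ite (measurableSet_le measurable_norm measurable_const) ?_ measurable_const
  fun_prop

lemma rpow_add_nat' {x : ℝ} (hx : 0 < x) (n : ℕ) (s : ℝ) : x ^ ((n:ℝ) + s) = x ^ s * x ^ n := by
  rw [Real.rpow_add hx, Real.rpow_natCast, mul_comm]

lemma tailK_int (hs0 : 0 < s) {d : ℝ} (hd : 0 < d) : Integrable (tailK n s d) := by
  have h := integrable_one_add_norm (E := Eucl n) (μ := volume) (r := (n:ℝ) + s) (by simp; exact hs0)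
  have hc : 0 < d / (1 + d) := by positivity
  refine (h.const_mul ((d / (1+d)) ^ ((n:ℝ)+s))⁻¹).mono' (tailK_meas d).aestronglyMeasurable ?_
  filter_upwards with z
  rw [Real.norm_of_nonneg (tailK_nonneg d z)]
  unfold tailK
  split_ifs with hz
  · have hz0 : 0 < ‖z‖ := hd.trans_le hz
    rw [← rpow_add_nat' hz0, Real.rpow_neg (by positivity), ← mul_inv, ← Real.mul_rpow hc.le (by positivity), one_div]
    apply inv_anti₀ (by positivity)
    apply Real.rpow_le_rpow (by positivity) _ (by positivity)
    rw [div_mul_eq_mul_div, div_le_iff₀ (by positivity)]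
    nlinarith
  · positivity

lemma nearK_int (hn : 1 ≤ n) {a : ℝ} (ha : 0 < a) : Integrable (nearK n a) := by
  have : Nonempty (Fin n) := ⟨⟨0, hn⟩⟩
  have e : nearK n a = fun z : Eucl n => (fun t : ℝ => if t ≤ 1 then t ^ a / t ^ n else 0) ‖z‖ := rfl
  rw [e]
  refine (integrable_fun_norm_addHaar (volume : Measure (Eucl n))
    (f := fun t : ℝ => if t ≤ 1 then t ^ a / t ^ n else 0)).2 ?_
  have hfr : Module.finrank ℝ (Eucl n) = n := by simp
  rw [hfr]
  have h1 : IntegrableOn (fun t : ℝ => t ^ (a - 1)) (Ioc 0 1) := by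
    rw [← intervalIntegrable_iff_integrableOn_Ioc_of_le zero_le_one]
    exact intervalIntegral.intervalIntegrable_rpow' (by linarith)
  have h2 : IntegrableOn (fun y : ℝ => y ^ (n-1) • (fun t : ℝ => if t ≤ 1 then t ^ a / t ^ n else 0) y) (Ioc 0 1) := by
    refine h1.congr_fun ?_ measurableSet_Ioc
    intro t ht
    have ht0 : 0 < t := ht.1
    simp only [ht.2, if_true, smul_eq_mul]
    rw [Real.rpow_sub_one ht0.ne']
    obtain ⟨m, rfl⟩ : ∃ m, n = m + 1 := ⟨n - 1, by omega⟩
    simp only [Nat.add_sub_cancel, pow_succ]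
    field_simp
  have h3 : IntegrableOn (fun y : ℝ => y ^ (n-1) • (fun t : ℝ => if t ≤ 1 then t ^ a / t ^ n else 0) y) (Ioi 1) := by
    refine (integrableOn_zero).congr_fun ?_ measurableSet_Ioi
    intro t ht
    have : ¬ t ≤ 1 := not_le.2 ht
    simp [this]
  have h4 := h2.union h3
  rwa [Ioc_union_Ioi_eq_Ioi zero_le_one] at h4

/-- Domination of functions living near the strip over a ball. -/
lemma strip_int {F : Eucl n × Eucl n → ℝ} (hF : AEStronglyMeasurable F) {k : Eucl n → ℝ}
    (hk : Integrable k) (hk0 : ∀ z, 0 ≤ k z) (hke : ∀ z, k (-z) = k z) (x₁ : Eucl n) (r : ℝ)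
    (hb : ∀ x y, |F (x, y)| ≤ k (x - y))
    (hz : ∀ x y, x ∉ closedBall x₁ r → y ∉ closedBall x₁ r → F (x, y) = 0) : Integrable F := by
  have hB : Integrable (indicator (closedBall x₁ r) (fun _ : Eucl n => (1:ℝ))) := by
    rw [integrable_indicator_iff measurableSet_closedBall]
    exact integrableOn_const (measure_closedBall_lt_top).ne
  have h1 : Integrable (fun p : Eucl n × Eucl n =>
      indicator (closedBall x₁ r) (fun _ : Eucl n => (1:ℝ)) p.2 * k (p.1 - p.2)) :=
    hB.convolution_integrand (ContinuousLinearMap.mul ℝ ℝ) hk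
  have h2 := h1.swap
  refine (h1.add h2).mono' hF ?_
  filter_upwards with p
  obtain ⟨x, y⟩ := p
  simp only [Pi.add_apply, Function.comp, Prod.swap]
  have e : k (y - x) = k (x - y) := by rw [← hke, neg_sub]
  rw [e, Real.norm_eq_abs]
  have := hb x y
  have h0 := hk0 (x - y)
  by_cases hx : x ∈ closedBall x₁ r <;> by_cases hy : y ∈ closedBall x₁ r
  · simp only [indicator_of_mem hx, indicator_of_mem hy]; linarith
  · simp only [indicator_of_mem hx, indicator_of_notMem hy]; linarith
  · simp only [indicator_of_notMem hx, indicator_of_mem hy]; linarith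
  · rw [hz x y hx hy]; simp only [indicator_of_notMem hx, indicator_of_notMem hy]; simp

/-- difference quotient -/
def DD (s : ℝ) (f : Eucl n → ℝ) (p : Eucl n × Eucl n) : ℝ := (f p.1 - f p.2) / ‖p.1 - p.2‖ ^ s

/-- energy density -/
def HD (s : ℝ) (g : ℝ → ℝ) (f : Eucl n → ℝ) (p : Eucl n × Eucl n) : ℝ :=
  HH g (DD s f p) / ‖p.1 - p.2‖ ^ n

lemma DD_meas {f : Eucl n → ℝ} (hf : Measurable f) : Measurable (DD s f) := by
  unfold DD
  exact ((hf.comp measurable_fst).sub (hf.comp measurable_snd)).div (by fun_prop)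

lemma HD_meas (hg : CondG g pg qg) {f : Eucl n → ℝ} (hf : Measurable f) : Measurable (HD s g f) := by
  unfold HD
  exact ((HH_cont hg).measurable.comp (DD_meas hf)).div (by fun_prop)

lemma HD_nonneg (hg : CondG g pg qg) (f : Eucl n → ℝ) (p) : 0 ≤ HD s g f p := by
  unfold HD; have := HH_nonneg hg (DD s f p); positivity

lemma DD_abs (f : Eucl n → ℝ) (p) : |DD s f p| = |f p.1 - f p.2| / ‖p.1 - p.2‖ ^ s := by
  unfold DD; rw [abs_div, abs_of_nonneg (a := ‖p.1 - p.2‖ ^ s) (by positivity)]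

lemma HH_le_mul (hg : CondG g pg qg) {a b M : ℝ} (h : |a| ≤ b) (hb : b ≤ M) : HH g a ≤ b * g M := by
  rw [← HH_abs hg]
  have h1 := cg_mono hg (h.trans hb)
  exact mul_le_mul h h1 (cg_nonneg hg (abs_nonneg a)) ((abs_nonneg a).trans h)

/-- tail bound for `HD` -/
lemma HD_tail (hg : CondG g pg qg) (hs0 : 0 < s) {f : Eucl n → ℝ} {M d : ℝ} (hd : 0 < d) (x y : Eucl n)
    (hM : |f x - f y| ≤ M) (hxy : d ≤ ‖x - y‖) :
    HD s g f (x, y) ≤ M * g (M / d ^ s) * tailK n s d (x - y) := by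
  have hz : 0 < ‖x - y‖ := hd.trans_le hxy
  have hM0 : 0 ≤ M := (abs_nonneg _).trans hM
  have h1 : HH g (DD s f (x, y)) ≤ (M / ‖x - y‖ ^ s) * g (M / d ^ s) := by
    apply HH_le_mul hg
    · rw [DD_abs]; dsimp only; gcongr
    · gcongr
  unfold HD tailK
  rw [if_pos hxy]
  dsimp only
  calc HH g (DD s f (x, y)) / ‖x - y‖ ^ n ≤ (M / ‖x - y‖ ^ s) * g (M / d ^ s) / ‖x - y‖ ^ n := by gcongr
    _ = _ := by field_simp

lemma HD_near (hg : CondG g pg qg) (hs1 : s < 1) {f : Eucl n → ℝ} {L : ℝ} (hL0 : 0 ≤ L) (x y : Eucl n)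
    (hL : |f x - f y| ≤ L * ‖x - y‖) (hxy : ‖x - y‖ ≤ 1) :
    HD s g f (x, y) ≤ L * g L * nearK n (1 - s) (x - y) := by
  unfold HD nearK
  rw [if_pos hxy]
  dsimp only
  rcases (norm_nonneg (x - y)).eq_or_lt with h0 | h0
  · have : DD s f (x,y) = 0 := by
      have : x = y := by rw [eq_comm, norm_eq_zero, sub_eq_zero] at h0; exact h0
      subst this; simp [DD]
    rw [this, HH_zero, zero_div]
    have := cg_nonneg hg hL0
    positivity
  have h1 : HH g (DD s f (x, y)) ≤ (L * ‖x - y‖ ^ (1 - s)) * g L := by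
    apply HH_le_mul hg
    · rw [DD_abs]; dsimp only
      rw [Real.rpow_sub h0, Real.rpow_one, mul_div_assoc']
      gcongr
    · have : ‖x - y‖ ^ (1 - s) ≤ 1 := Real.rpow_le_one h0.le hxy (by linarith)
      nlinarith
  calc HH g (DD s f (x, y)) / ‖x - y‖ ^ n ≤ (L * ‖x - y‖ ^ (1 - s)) * g L / ‖x - y‖ ^ n := by gcongr
    _ = _ := by ring

lemma HD_lip_int (hn : 1 ≤ n) (hg : CondG g pg qg) (hs0 : 0 < s) (hs1 : s < 1) {f : Eucl n → ℝ}
    (hf : Measurable f) {L M : ℝ} (hL0 : 0 ≤ L) (hL : ∀ x y, |f x - f y| ≤ L * ‖x - y‖)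
    (hM : ∀ x y, |f x - f y| ≤ M) (x₁ : Eucl n) (r : ℝ)
    (hz : ∀ x y, x ∉ closedBall x₁ r → y ∉ closedBall x₁ r → f x = f y) :
    Integrable (HD s g f) := by
  have hM0 : 0 ≤ M := (abs_nonneg _).trans (hM 0 0)
  have hgM := cg_nonneg hg hM0
  have hgL := cg_nonneg hg hL0
  refine strip_int (k := fun z => L * g L * nearK n (1-s) z + M * g (M / 1 ^ s) * tailK n s 1 z)
    (HD_meas hg hf).aestronglyMeasurable ?_ ?_ ?_ x₁ r ?_ ?_
  · exact ((nearK_int hn (by linarith)).const_mul _).add ((tailK_int hs0 one_pos).const_mul _)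
  · intro z
    have := nearK_nonneg (n := n) (1-s) z
    have := tailK_nonneg (n := n) (s := s) 1 z
    simp only [Real.one_rpow, div_one]
    positivity
  · intro z; simp only [nearK_neg, tailK_neg]
  · intro x y
    rw [abs_of_nonneg (HD_nonneg hg f _)]
    have h1 := nearK_nonneg (n := n) (1-s) (x - y)
    have h2 := tailK_nonneg (n := n) (s := s) 1 (x - y)
    rcases le_total ‖x - y‖ 1 with h | h
    · have := HD_near hg hs1 hL0 x y (hL x y) h
      have : 0 ≤ M * g (M / 1 ^ s) * tailK n s 1 (x - y) := by
        simp only [Real.one_rpow, div_one]; positivity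
      linarith
    · have := HD_tail hg hs0 one_pos x y (hM x y) h
      have : 0 ≤ L * g L * nearK n (1-s) (x - y) := by positivity
      linarith
  · intro x y hx hy
    simp [HD, DD, hz x y hx hy, HH_zero]

lemma HD_supp_int (hg : CondG g pg qg) (hs0 : 0 < s) {f : Eucl n → ℝ}
    (hf : Measurable f) {M : ℝ} (hM : ∀ x y, |f x - f y| ≤ M) (x₁ : Eucl n) {r r' : ℝ} (hr : r < r')
    (hz : ∀ x, x ∉ closedBall x₁ r → f x = 0)
    (hi : IntegrableOn (HD s g f) (ball x₁ r' ×ˢ ball x₁ r')) :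
    Integrable (HD s g f) := by
  have hM0 : 0 ≤ M := (abs_nonneg _).trans (hM 0 0)
  have hd : 0 < r' - r := by linarith
  have hgM : 0 ≤ g (M / (r' - r) ^ s) := cg_nonneg hg (by positivity)
  have hms : MeasurableSet (ball x₁ r' ×ˢ ball x₁ r') := measurableSet_ball.prod measurableSet_ball
  have h1 : Integrable (indicator (ball x₁ r' ×ˢ ball x₁ r')ᶜ (HD s g f)) := by
    refine strip_int (k := fun z => M * g (M / (r'-r) ^ s) * tailK n s (r'-r) z)
      ((HD_meas hg hf).indicator hms.compl).aestronglyMeasurable ?_ ?_ ?_ x₁ r ?_ ?_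
    · exact ((tailK_int hs0 hd).const_mul _)
    · intro z
      have := tailK_nonneg (n := n) (s := s) (r'-r) z
      positivity
    · intro z; simp only [tailK_neg]
    · intro x y
      have h2 := tailK_nonneg (n := n) (s := s) (r'-r) (x - y)
      have hpos : 0 ≤ M * g (M / (r'-r) ^ s) * tailK n s (r'-r) (x - y) := by positivity
      by_cases hxy : (x, y) ∈ (ball x₁ r' ×ˢ ball x₁ r')ᶜ
      · rw [indicator_of_mem hxy, abs_of_nonneg (HD_nonneg hg f _)]
        by_cases hfx : x ∈ closedBall x₁ r ∨ y ∈ closedBall x₁ r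
        · apply HD_tail hg hs0 hd x y (hM x y)
          simp only [mem_compl_iff, mem_prod, mem_ball, not_and_or, not_lt] at hxy
          simp only [mem_closedBall] at hfx
          rw [← dist_eq_norm]
          rcases hfx with hx | hy
          · rcases hxy with h | h
            · linarith
            · have := dist_triangle_left y x₁ x
              linarith
          · rcases hxy with h | h
            · have := dist_triangle x y x₁
              linarith
            · linarith
        · push Not at hfx
          simp only [HD, DD, hz x hfx.1, hz y hfx.2]
          simpa [HH_zero] using hpos
      · rw [indicator_of_notMem hxy]; simpa using hpos
    · intro x y hx hy
      by_cases hxy : (x, y) ∈ (ball x₁ r' ×ˢ ball x₁ r')ᶜ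
      · rw [indicator_of_mem hxy]
        simp [HD, DD, hz x hx, hz y hy, HH_zero]
      · rw [indicator_of_notMem hxy]
  have h2 := (integrable_indicator_iff hms).2 hi
  have h3 := h1.add h2
  rwa [indicator_compl_add_self] at h3

end PartB

section PartC
variable {n : ℕ} {s : ℝ} {g : ℝ → ℝ} {pg qg : ℝ} {K : Eucl n → Eucl n → ℝ} {lam Lam : ℝ}

/-- the convolution kernel -/
def kk (K : Eucl n → Eucl n → ℝ) (z : Eucl n) : ℝ := if z = 0 then 0 else K 0 z

lemma kk_neg (hK : CondK n K lam Lam) (z : Eucl n) : kk K (-z) = kk K z := by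
  unfold kk
  by_cases h : z = 0
  · simp [h]
  · rw [if_neg h, if_neg (neg_ne_zero.2 h)]
    have := hK.transl 0 (-z) z
    simp only [zero_add, neg_add_cancel] at this
    rw [← this, hK.symm]

lemma kk_eq (hK : CondK n K lam Lam) {x y : Eucl n} (h : x ≠ y) : K x y = kk K (x - y) := by
  unfold kk
  rw [if_neg (sub_ne_zero.2 h)]
  have := hK.transl 0 (x - y) y
  simp only [zero_add, sub_add_cancel] at this
  rw [← this, hK.symm]

lemma kk_nonneg (hK : CondK n K lam Lam) (z : Eucl n) : 0 ≤ kk K z := by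
  unfold kk
  split_ifs with h
  · exact le_rfl
  · have := hK.lower 0 z (Ne.symm h)
    have h2 := hK.lam_pos
    exact le_trans (by positivity) this

lemma Lam_pos (hK : CondK n K lam Lam) : 0 < Lam := hK.lam_pos.trans_le hK.lam_le_Lam

lemma kk_le (hK : CondK n K lam Lam) (z : Eucl n) : kk K z ≤ Lam / ‖z‖ ^ n := by
  unfold kk
  split_ifs with h
  · have := Lam_pos hK; positivity
  · have := hK.upper 0 z (Ne.symm h)
    simpa using this

lemma kk_ge (hK : CondK n K lam Lam) {z : Eucl n} (hz : z ≠ 0) : lam / ‖z‖ ^ n ≤ kk K z := by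
  unfold kk
  rw [if_neg hz]
  have := hK.lower 0 z (Ne.symm hz)
  simpa using this

lemma kk_meas (hK : CondK n K lam Lam) : Measurable (kk K) := by
  have h1 : ContinuousOn (fun z : Eucl n => K 0 z) {0}ᶜ := by
    have : ContinuousOn (fun z : Eucl n => ((0 : Eucl n), z)) {0}ᶜ := by fun_prop
    refine hK.cont.comp this ?_
    intro z hz
    exact Ne.symm hz
  have h2 : kk K = ({0}ᶜ : Set (Eucl n)).piecewise (fun z => K 0 z) (fun _ => 0) := by
    funext z
    by_cases h : z = 0 <;> simp [kk, h]
  rw [h2]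
  exact h1.measurable_piecewise continuousOn_const (measurableSet_singleton 0).compl

/-- energy integrand -/
def EI (s : ℝ) (g : ℝ → ℝ) (K : Eucl n → Eucl n → ℝ) (u η : Eucl n → ℝ) (p : Eucl n × Eucl n) : ℝ :=
  g (DD s u p) * DD s η p * kk K (p.1 - p.2)

lemma energy_eq (hg : CondG g pg qg) (hK : CondK n K lam Lam) (u η : Eucl n → ℝ) :
    energy n s g K u η = ∫ p, EI s g K u η p := by
  unfold energy
  congr 1
  funext p
  obtain ⟨x, y⟩ := p
  by_cases h : x = y
  · subst h; simp [EI, DD, hg.zero]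
  · simp only [EI, DD]
    rw [kk_eq hK h]
    ring

lemma EI_meas (hg : CondG g pg qg) (hK : CondK n K lam Lam) {u η : Eucl n → ℝ} (hu : Measurable u)
    (hη : Measurable η) : Measurable (EI s g K u η) := by
  unfold EI
  exact (((cg_cont hg).measurable.comp (DD_meas hu)).mul (DD_meas hη)).mul
    ((kk_meas hK).comp (measurable_fst.sub measurable_snd))

lemma EI_young (hg : CondG g pg qg) (hK : CondK n K lam Lam) (u η : Eucl n → ℝ) (p) :
    |EI s g K u η p| ≤ Lam * (HD s g u p + HD s g η p) := by
  unfold EI HD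
  rw [abs_mul, abs_of_nonneg (kk_nonneg hK _)]
  have h1 := HH_young hg (DD s u p) (DD s η p)
  have h2 := kk_le hK (p.1 - p.2)
  have h3 := HH_nonneg hg (DD s u p)
  have h4 := HH_nonneg hg (DD s η p)
  calc _ ≤ (HH g (DD s u p) + HH g (DD s η p)) * (Lam / ‖p.1 - p.2‖ ^ n) := by
        apply mul_le_mul h1 h2 (kk_nonneg hK _) (by positivity)
    _ = _ := by ring

/-- product-type tail dominating function -/
def tauT (n : ℕ) (s : ℝ) (g : ℝ → ℝ) (u : Eucl n → ℝ) (a b : ℝ) (y : Eucl n) : ℝ :=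
  a * ((b + g (|u y| / (1 + ‖y‖) ^ s)) / (1 + ‖y‖) ^ ((n:ℝ) + s))

lemma tauT_int (hs0 : 0 < s) {u : Eucl n → ℝ} (hu : MemLgs n s g u) (a b : ℝ) :
    Integrable (tauT n s g u a b) := by
  have h := integrable_one_add_norm (E := Eucl n) (μ := volume) (r := (n:ℝ) + s) (by simp; exact hs0)
  have h2 := ((h.const_mul b).add hu.2).const_mul a
  refine h2.congr ?_
  filter_upwards with y
  simp only [tauT, Pi.add_apply]
  rw [Real.rpow_neg (by positivity)]
  ring

lemma tail_pt (hg : CondG g pg qg) (hK : CondK n K lam Lam) (hs0 : 0 < s)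
    {u : Eucl n → ℝ} (x₁ : Eucl n) {r₁ r' Mu M : ℝ} (hr : r₁ < r') (hr0 : 0 ≤ r₁)
    (hMu : 0 ≤ Mu) (hM : 0 ≤ M) :
    ∃ a b : ℝ, 0 ≤ a ∧ 0 ≤ b ∧ ∀ x y, x ∈ closedBall x₁ r₁ → y ∉ ball x₁ r' → |u x| ≤ Mu →
      g ((|u x| + |u y|) / ‖x - y‖ ^ s) * (M / ‖x - y‖ ^ s) * kk K (x - y) ≤ tauT n s g u a b y := by
  set d := r' - r₁ with hd
  have hd0 : 0 < d := by linarith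
  set A := (1 + ‖x₁‖ + r₁) / d + 1 with hA
  have hA1 : 1 ≤ A := by
    have : 0 ≤ (1 + ‖x₁‖ + r₁) / d := by positivity
    linarith
  have hA0 : 0 < A := by linarith
  have hL := Lam_pos hK
  have hgMu := cg_nonneg hg hMu
  refine ⟨(A ^ s) ^ qg * 2 ^ qg * (M * A ^ s * (Lam * A ^ n)), g Mu, by positivity, hgMu, ?_⟩
  intro x y hx hy hux
  have h1 : d ≤ ‖x - y‖ := by
    rw [mem_closedBall] at hx
    rw [mem_ball, not_lt] at hy
    have := dist_triangle_left y x₁ x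
    rw [← dist_eq_norm]; linarith
  have hz0 : 0 < ‖x - y‖ := hd0.trans_le h1
  have h2 : 1 + ‖y‖ ≤ A * ‖x - y‖ := by
    have hx1 : ‖x‖ ≤ ‖x₁‖ + r₁ := by
      rw [mem_closedBall, dist_eq_norm] at hx
      have := norm_le_norm_add_norm_sub' x x₁
      linarith
    have hy1 : ‖y‖ ≤ ‖x‖ + ‖x - y‖ := by
      have := norm_le_norm_add_norm_sub x y
      linarith
    have : (1 + ‖x₁‖ + r₁) ≤ (1 + ‖x₁‖ + r₁) / d * ‖x - y‖ := by
      rw [div_mul_eq_mul_div, le_div_iff₀ hd0]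
      have : 0 ≤ 1 + ‖x₁‖ + r₁ := by positivity
      nlinarith
    rw [hA]; linarith
  set w := 1 + ‖y‖ with hw
  have hw1 : 1 ≤ w := by have := norm_nonneg y; linarith
  have hw0 : 0 < w := by linarith
  have hws : w ^ s ≤ A ^ s * ‖x - y‖ ^ s := by
    rw [← Real.mul_rpow hA0.le hz0.le]
    exact Real.rpow_le_rpow hw0.le h2 hs0.le
  have hwn : w ^ n ≤ A ^ n * ‖x - y‖ ^ n := by
    rw [← mul_pow]
    exact pow_le_pow_left₀ hw0.le h2 n
  have hzs : 0 < ‖x - y‖ ^ s := Real.rpow_pos_of_pos hz0 s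
  have hwsp : 0 < w ^ s := Real.rpow_pos_of_pos hw0 s
  have hws1 : 1 ≤ w ^ s := Real.one_le_rpow hw1 hs0.le
  have hAs1 : 1 ≤ A ^ s := Real.one_le_rpow hA1 hs0.le
  have inv1 : 1 / ‖x - y‖ ^ s ≤ A ^ s / w ^ s := by
    rw [div_le_div_iff₀ hzs hwsp]; linarith
  have inv2 : 1 / ‖x - y‖ ^ n ≤ A ^ n / w ^ n := by
    rw [div_le_div_iff₀ (by positivity) (by positivity)]; linarith
  have e1 : g ((|u x| + |u y|) / ‖x - y‖ ^ s) ≤ (A ^ s) ^ qg * (2 ^ qg * (g Mu + g (|u y| / w ^ s))) := by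
    calc g ((|u x| + |u y|) / ‖x - y‖ ^ s) ≤ g (A ^ s * (Mu + |u y| / w ^ s)) := by
          apply cg_mono hg
          calc (|u x| + |u y|) / ‖x - y‖ ^ s = (|u x| + |u y|) * (1 / ‖x - y‖ ^ s) := by ring
            _ ≤ (Mu + |u y|) * (A ^ s / w ^ s) := by gcongr
            _ = A ^ s * (Mu / w ^ s + |u y| / w ^ s) := by ring
            _ ≤ _ := by
              gcongr
              exact div_le_self hMu hws1
      _ ≤ (A ^ s) ^ qg * g (Mu + |u y| / w ^ s) := cg_scale hg hAs1 (by positivity)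
      _ ≤ _ := by
        gcongr
        exact cg_add hg hMu (by positivity)
  have e2 : M / ‖x - y‖ ^ s ≤ M * A ^ s / w ^ s := by
    calc M / ‖x - y‖ ^ s = M * (1 / ‖x - y‖ ^ s) := by ring
      _ ≤ M * (A ^ s / w ^ s) := by gcongr
      _ = _ := by ring
  have e3 : kk K (x - y) ≤ Lam * A ^ n / w ^ n := by
    calc kk K (x - y) ≤ Lam / ‖x - y‖ ^ n := kk_le hK _
      _ = Lam * (1 / ‖x - y‖ ^ n) := by ring
      _ ≤ Lam * (A ^ n / w ^ n) := by gcongr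
      _ = _ := by ring
  have hgy : 0 ≤ g (|u y| / w ^ s) := cg_nonneg hg (by positivity)
  calc _ ≤ ((A ^ s) ^ qg * (2 ^ qg * (g Mu + g (|u y| / w ^ s)))) * (M * A ^ s / w ^ s) * (Lam * A ^ n / w ^ n) := by
        apply mul_le_mul _ e3 (kk_nonneg hK _) (by positivity)
        apply mul_le_mul e1 e2 (by positivity) (by positivity)
    _ = _ := by
      unfold tauT
      rw [← hw, rpow_add_nat' hw0]
      field_simp

lemma EI_dom (hg : CondG g pg qg) (hK : CondK n K lam Lam) (hs0 : 0 < s)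
    {u : Eucl n → ℝ} (hu : MemLgs n s g u) (x₁ : Eucl n) {r₁ r' Mu M : ℝ} (hr : r₁ < r') (hr0 : 0 ≤ r₁)
    (hMu : ∀ x ∈ closedBall x₁ r₁, |u x| ≤ Mu) (hM : 0 ≤ M)
    (hi : IntegrableOn (HD s g u) (ball x₁ r' ×ˢ ball x₁ r')) :
    ∃ D0 : Eucl n × Eucl n → ℝ, Integrable D0 ∧ ∀ η : Eucl n → ℝ, (∀ x, |η x| ≤ M) →
      (∀ x, x ∉ closedBall x₁ r₁ → η x = 0) → ∀ p, |EI s g K u η p| ≤ D0 p + Lam * HD s g η p := by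
  have hMu0 : 0 ≤ Mu := (abs_nonneg _).trans (hMu x₁ (mem_closedBall_self hr0))
  obtain ⟨a, b, ha, hb, hab⟩ := tail_pt hg hK hs0 (u := u) x₁ hr hr0 hMu0 hM
  have hL := Lam_pos hK
  have hms : MeasurableSet (ball x₁ r' ×ˢ ball x₁ r') := measurableSet_ball.prod measurableSet_ball
  have hB : Integrable (indicator (closedBall x₁ r₁) (fun _ : Eucl n => (1:ℝ))) := by
    rw [integrable_indicator_iff measurableSet_closedBall]
    exact integrableOn_const (measure_closedBall_lt_top).ne
  have hT : Integrable (fun p : Eucl n × Eucl n =>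
      indicator (closedBall x₁ r₁) (fun _ : Eucl n => (1:ℝ)) p.1 * tauT n s g u a b p.2) :=
    hB.mul_prod (tauT_int hs0 hu a b)
  have hT' := hT.swap
  have hH := ((integrable_indicator_iff hms).2 hi).const_mul Lam
  refine ⟨_, (hH.add hT).add hT', ?_⟩
  intro η hη hηz p
  obtain ⟨x, y⟩ := p
  simp only [Pi.add_apply, Function.comp, Prod.swap]
  have t0 : ∀ y, 0 ≤ tauT n s g u a b y := by
    intro y
    have : 0 ≤ g (|u y| / (1 + ‖y‖) ^ s) := cg_nonneg hg (by positivity)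
    unfold tauT; positivity
  have i0 : ∀ x : Eucl n, 0 ≤ indicator (closedBall x₁ r₁) (fun _ : Eucl n => (1:ℝ)) x := by
    intro x; exact indicator_nonneg (fun _ _ => zero_le_one) x
  have q1 := mul_nonneg (i0 x) (t0 y)
  have q2 := mul_nonneg (i0 y) (t0 x)
  have q3 := HD_nonneg (s := s) hg η (x, y)
  have q3' : 0 ≤ Lam * HD s g η (x, y) := by positivity
  have q4 : 0 ≤ Lam * (ball x₁ r' ×ˢ ball x₁ r').indicator (HD s g u) (x, y) := by
    have : 0 ≤ (ball x₁ r' ×ˢ ball x₁ r').indicator (HD s g u) (x, y) :=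
      indicator_nonneg (fun p _ => HD_nonneg hg u p) _
    positivity
  have hsub : closedBall x₁ r₁ ⊆ ball x₁ r' := closedBall_subset_ball hr
  have gen : ∀ x y, x ∈ closedBall x₁ r₁ → y ∉ ball x₁ r' →
      |EI s g K u η (x, y)| ≤ tauT n s g u a b y := by
    intro x y hx hy
    refine le_trans ?_ (hab x y hx hy (hMu x hx))
    unfold EI
    rw [abs_mul, abs_mul, abs_of_nonneg (kk_nonneg hK _), cg_abs hg, DD_abs, DD_abs]
    dsimp only
    have hηy : η y = 0 := hηz y (fun h => hy (hsub h))
    have := kk_nonneg hK (x - y)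
    have h1 : g (|u x - u y| / ‖x - y‖ ^ s) ≤ g ((|u x| + |u y|) / ‖x - y‖ ^ s) := by
      apply cg_mono hg
      gcongr
      exact abs_sub _ _
    have h2 : 0 ≤ g ((|u x| + |u y|) / ‖x - y‖ ^ s) := cg_nonneg hg (by positivity)
    have h3 : |η x - η y| ≤ M := by rw [hηy, sub_zero]; exact hη x
    gcongr
  have sym : |EI s g K u η (x, y)| = |EI s g K u η (y, x)| := by
    unfold EI
    rw [abs_mul, abs_mul, abs_mul, abs_mul, cg_abs hg, cg_abs hg, DD_abs, DD_abs, DD_abs, DD_abs]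
    dsimp only
    rw [abs_sub_comm (u x), abs_sub_comm (η x), norm_sub_rev x y, ← kk_neg hK, neg_sub]
  by_cases hx : x ∈ ball x₁ r' <;> by_cases hy : y ∈ ball x₁ r'
  · have hxy : (x, y) ∈ ball x₁ r' ×ˢ ball x₁ r' := ⟨hx, hy⟩
    have := EI_young (s := s) hg hK u η (x, y)
    rw [indicator_of_mem hxy]
    linarith
  · by_cases hx1 : x ∈ closedBall x₁ r₁
    · have := gen x y hx1 hy
      rw [indicator_of_mem hx1, one_mul] at q1 ⊢
      linarith
    · have : EI s g K u η (x, y) = 0 := by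
        have hηy : η y = 0 := hηz y (fun h => hy (hsub h))
        simp [EI, DD, hηy, hηz x hx1]
      rw [this, abs_zero]; linarith
  · by_cases hy1 : y ∈ closedBall x₁ r₁
    · have := gen y x hy1 hx
      rw [sym]
      rw [indicator_of_mem hy1, one_mul] at q2 ⊢
      linarith
    · have : EI s g K u η (x, y) = 0 := by
        have hηy : η x = 0 := hηz x (fun h => hx (hsub h))
        simp [EI, DD, hηy, hηz y hy1]
      rw [this, abs_zero]; linarith
  · have : EI s g K u η (x, y) = 0 := by
      have hηy : η y = 0 := hηz y (fun h => hy (hsub h))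
      have hηx : η x = 0 := hηz x (fun h => hx (hsub h))
      simp [EI, DD, hηy, hηx]
    rw [this, abs_zero]; linarith

end PartC

section PartD

lemma fatou_one_sided {α : Type*} [MeasurableSpace α] {μ : Measure α} {F P : ℕ → α → ℝ}
    {F0 P0 D : α → ℝ} (hD : Integrable D μ) (hP : ∀ k, Integrable (P k) μ) (hP0 : Integrable P0 μ)
    (hF : ∀ k, Integrable (F k) μ) (hF0 : Integrable F0 μ)
    (hbd : ∀ k x, |F k x| ≤ D x + P k x)
    (hlF : ∀ x, Tendsto (fun k => F k x) atTop (𝓝 (F0 x)))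
    (hlP : ∀ x, Tendsto (fun k => P k x) atTop (𝓝 (P0 x)))
    (hPle : ∀ k, ∫ x, P k x ∂μ ≤ ∫ x, P0 x ∂μ)
    {a : ℕ → ℝ} {a0 : ℝ} (ha : Tendsto a atTop (𝓝 a0)) (h : ∀ k, a k ≤ ∫ x, F k x ∂μ) :
    a0 ≤ ∫ x, F0 x ∂μ := by
  set Q : ℕ → α → ℝ := fun k x => D x + P k x - F k x with hQ
  set Q0 : α → ℝ := fun x => D x + P0 x - F0 x with hQ0
  have hQi : ∀ k, Integrable (Q k) μ := fun k => (hD.add (hP k)).sub (hF k)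
  have hQ0i : Integrable Q0 μ := (hD.add hP0).sub hF0
  have hQn : ∀ k x, 0 ≤ Q k x := by
    intro k x
    have := (abs_le.1 (hbd k x)).2
    simp only [hQ]; linarith
  have hlQ : ∀ x, Tendsto (fun k => Q k x) atTop (𝓝 (Q0 x)) := fun x =>
    (tendsto_const_nhds.add (hlP x)).sub (hlF x)
  have hQ0n : ∀ x, 0 ≤ Q0 x := fun x => ge_of_tendsto' (hlQ x) (fun k => hQn k x)
  have hb : ∀ k, ∫ x, Q k x ∂μ ≤ ∫ x, D x ∂μ + ∫ x, P0 x ∂μ - a k := by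
    intro k
    have : ∫ x, Q k x ∂μ = ∫ x, D x ∂μ + ∫ x, P k x ∂μ - ∫ x, F k x ∂μ := by
      rw [← integral_add hD (hP k)]
      exact integral_sub (hD.add (hP k)) (hF k)
    rw [this]
    linarith [h k, hPle k]
  have hlim : Tendsto (fun k => ∫ x, D x ∂μ + ∫ x, P0 x ∂μ - a k) atTop
      (𝓝 (∫ x, D x ∂μ + ∫ x, P0 x ∂μ - a0)) := tendsto_const_nhds.sub ha
  have hnn : 0 ≤ ∫ x, D x ∂μ + ∫ x, P0 x ∂μ - a0 :=
    ge_of_tendsto' hlim (fun k => (integral_nonneg (hQn k)).trans (hb k))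
  have key : ENNReal.ofReal (∫ x, Q0 x ∂μ) ≤ ENNReal.ofReal (∫ x, D x ∂μ + ∫ x, P0 x ∂μ - a0) := by
    rw [ofReal_integral_eq_lintegral_ofReal hQ0i (Eventually.of_forall hQ0n)]
    have e : ∀ x, ENNReal.ofReal (Q0 x) = liminf (fun k => ENNReal.ofReal (Q k x)) atTop := by
      intro x
      exact ((ENNReal.continuous_ofReal.tendsto _).comp (hlQ x)).liminf_eq.symm
    simp_rw [e]
    refine (lintegral_liminf_le' (fun k => (hQi k).1.aemeasurable.ennreal_ofReal)).trans ?_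
    have e2 := ((ENNReal.continuous_ofReal.tendsto _).comp hlim).liminf_eq
    rw [← e2]
    refine liminf_le_liminf (Eventually.of_forall fun k => ?_)
    · rw [← ofReal_integral_eq_lintegral_ofReal (hQi k) (Eventually.of_forall (hQn k))]
      exact ENNReal.ofReal_le_ofReal (hb k)
  rw [ENNReal.ofReal_le_ofReal_iff hnn] at key
  have : ∫ x, Q0 x ∂μ = ∫ x, D x ∂μ + ∫ x, P0 x ∂μ - ∫ x, F0 x ∂μ := by
    rw [← integral_add hD hP0]
    exact integral_sub (hD.add hP0) hF0
  linarith

end PartD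

section PartE
variable {n : ℕ} {s : ℝ} {g : ℝ → ℝ} {pg qg : ℝ}

/-- mollifying measure -/
def mollM (φ : ContDiffBump (0 : Eucl n)) : Measure (Eucl n) :=
  (volume : Measure (Eucl n)).withDensity (fun z => ENNReal.ofReal (φ.normed volume z))

/-- mollification -/
def moll (φ : ContDiffBump (0 : Eucl n)) (η : Eucl n → ℝ) (x : Eucl n) : ℝ :=
  ∫ z, η (x - z) ∂(mollM φ)

lemma mollM_prob (φ : ContDiffBump (0 : Eucl n)) : IsProbabilityMeasure (mollM φ) := by
  constructor
  unfold mollM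
  rw [withDensity_apply _ MeasurableSet.univ, Measure.restrict_univ,
    ← ofReal_integral_eq_lintegral_ofReal φ.integrable_normed (Eventually.of_forall φ.nonneg_normed),
    φ.integral_normed, ENNReal.ofReal_one]

lemma moll_eq (φ : ContDiffBump (0 : Eucl n)) (η : Eucl n → ℝ) :
    moll φ η = convolution (φ.normed volume) η (ContinuousLinearMap.lsmul ℝ ℝ) volume := by
  funext x
  unfold moll mollM convolution
  rw [integral_withDensity_eq_integral_toReal_smul]
  · apply integral_congr_ae
    filter_upwards with z
    rw [ENNReal.toReal_ofReal (φ.nonneg_normed z)]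
    simp
  · exact φ.continuous_normed.measurable.ennreal_ofReal
  · filter_upwards with z using ENNReal.ofReal_lt_top

lemma mollM_ae (φ : ContDiffBump (0 : Eucl n)) : ∀ᵐ z ∂(mollM φ), ‖z‖ < φ.rOut := by
  have hm : Measurable (fun z => ENNReal.ofReal (φ.normed volume z)) :=
    φ.continuous_normed.measurable.ennreal_ofReal
  unfold mollM
  rw [ae_withDensity_iff hm]
  filter_upwards with z hz
  have : z ∈ Function.support (φ.normed volume) := by
    intro h
    apply hz
    rw [h, ENNReal.ofReal_zero]
  rw [φ.support_normed_eq] at this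
  simpa using this

lemma moll_int (φ : ContDiffBump (0 : Eucl n)) {f : Eucl n → ℝ} (hf : Continuous f) {M : ℝ}
    (hM : ∀ x, |f x| ≤ M) : Integrable f (mollM φ) := by
  have := mollM_prob φ
  exact Integrable.of_bound hf.aestronglyMeasurable M (Eventually.of_forall hM)

lemma moll_contDiff (φ : ContDiffBump (0 : Eucl n)) {η : Eucl n → ℝ} (hη : Continuous η) :
    ContDiff ℝ (⊤ : ℕ∞) (moll φ η) := by
  rw [moll_eq]
  exact φ.hasCompactSupport_normed.contDiff_convolution_left _ φ.contDiff_normed hη.locallyIntegrable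

lemma moll_nonneg (φ : ContDiffBump (0 : Eucl n)) {η : Eucl n → ℝ} (h0 : ∀ x, 0 ≤ η x) (x) :
    0 ≤ moll φ η x := integral_nonneg (fun z => h0 _)

lemma moll_le (φ : ContDiffBump (0 : Eucl n)) {η : Eucl n → ℝ} {M : ℝ} (hM : ∀ x, |η x| ≤ M) (x) :
    |moll φ η x| ≤ M := by
  have := mollM_prob φ
  unfold moll
  have h := norm_integral_le_of_norm_le_const (μ := mollM φ) (f := fun z => η (x - z)) (C := M)
    (Eventually.of_forall (fun z => hM _))
  simpa using h

lemma moll_supp (φ : ContDiffBump (0 : Eucl n)) {η : Eucl n → ℝ} {x₁ : Eucl n} {r : ℝ}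
    (hz : ∀ x, x ∉ closedBall x₁ r → η x = 0) (x) (hx : x ∉ closedBall x₁ (r + φ.rOut)) :
    moll φ η x = 0 := by
  unfold moll
  apply integral_eq_zero_of_ae
  filter_upwards [mollM_ae φ] with z hz'
  apply hz
  intro h
  apply hx
  rw [mem_closedBall, dist_eq_norm] at h ⊢
  calc ‖x - x₁‖ = ‖(x - z - x₁) + z‖ := by congr 1; abel
    _ ≤ ‖x - z - x₁‖ + ‖z‖ := norm_add_le _ _
    _ ≤ _ := by linarith

lemma moll_HD_le (hg : CondG g pg qg) (φ : ContDiffBump (0 : Eucl n)) {η : Eucl n → ℝ}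
    (hη : Continuous η) {M : ℝ} (hM : ∀ x, |η x| ≤ M) (p : Eucl n × Eucl n) :
    ENNReal.ofReal (HD s g (moll φ η) p) ≤
      ∫⁻ z, ENNReal.ofReal (HD s g η (p - (z, z))) ∂(mollM φ) := by
  have := mollM_prob φ
  obtain ⟨x, y⟩ := p
  have i1 : Integrable (fun z => η (x - z)) (mollM φ) := moll_int φ (by fun_prop) (fun z => hM _)
  have i2 : Integrable (fun z => η (y - z)) (mollM φ) := moll_int φ (by fun_prop) (fun z => hM _)
  have e0 : ∀ z, DD s η ((x, y) - (z, z)) = (η (x - z) - η (y - z)) / ‖x - y‖ ^ s := by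
    intro z; simp [DD]
  have e1 : DD s (moll φ η) (x, y) = ∫ z, DD s η ((x, y) - (z, z)) ∂(mollM φ) := by
    simp_rw [e0]
    rw [integral_div, integral_sub i1 i2]
    rfl
  have hc : Continuous (fun z => DD s η ((x, y) - (z, z))) := by
    simp_rw [e0]; fun_prop
  have hb : ∀ z, |DD s η ((x, y) - (z, z))| ≤ (M + M) / ‖x - y‖ ^ s := by
    intro z
    rw [e0, abs_div, abs_of_nonneg (a := ‖x - y‖ ^ s) (by positivity)]
    gcongr
    exact (abs_sub _ _).trans (add_le_add (hM _) (hM _))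
  have hi : Integrable (fun z => DD s η ((x, y) - (z, z))) (mollM φ) := moll_int φ hc hb
  have hi2 : Integrable (HH g ∘ fun z => DD s η ((x, y) - (z, z))) (mollM φ) := by
    refine moll_int φ ((HH_cont hg).comp hc) (M := HH g ((M + M) / ‖x - y‖ ^ s)) ?_
    intro z
    rw [Function.comp, abs_of_nonneg (HH_nonneg hg _)]
    exact HH_le_of_abs hg (hb z)
  have J := (HH_convex hg).map_integral_le (HH_cont hg).continuousOn isClosed_univ
    (Eventually.of_forall (fun _ => mem_univ _)) hi hi2
  have e2 : ∀ z, HD s g η ((x, y) - (z, z)) = HH g (DD s η ((x, y) - (z, z))) / ‖x - y‖ ^ n := by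
    intro z; simp [HD]
  have hi3 : Integrable (fun z => HD s g η ((x, y) - (z, z))) (mollM φ) := by
    simp_rw [e2]; exact hi2.div_const _
  rw [← ofReal_integral_eq_lintegral_ofReal hi3 (Eventually.of_forall (fun z => HD_nonneg hg _ _))]
  apply ENNReal.ofReal_le_ofReal
  simp_rw [e2]
  rw [integral_div]
  unfold HD
  rw [e1]
  dsimp only
  gcongr

lemma moll_HD (hg : CondG g pg qg) (φ : ContDiffBump (0 : Eucl n)) {η : Eucl n → ℝ}
    (hη : Continuous η) {M : ℝ} (hM : ∀ x, |η x| ≤ M) (hi : Integrable (HD s g η)) :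
    Integrable (HD s g (moll φ η)) ∧ ∫ p, HD s g (moll φ η) p ≤ ∫ p, HD s g η p := by
  have := mollM_prob φ
  have hmm : Measurable (HD s g (moll φ η)) := HD_meas hg (moll_contDiff φ hη).continuous.measurable
  have hm : Measurable (HD s g η) := HD_meas hg hη.measurable
  have key : ∫⁻ p, ENNReal.ofReal (HD s g (moll φ η) p) ≤ ∫⁻ p, ENNReal.ofReal (HD s g η p) := by
    calc ∫⁻ p, ENNReal.ofReal (HD s g (moll φ η) p)
        ≤ ∫⁻ p : Eucl n × Eucl n, ∫⁻ z, ENNReal.ofReal (HD s g η (p - (z, z))) ∂(mollM φ) :=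
          lintegral_mono (fun p => moll_HD_le hg φ hη hM p)
      _ = ∫⁻ z, (∫⁻ p : Eucl n × Eucl n, ENNReal.ofReal (HD s g η (p - (z, z)))) ∂(mollM φ) := by
          rw [lintegral_lintegral_swap]
          apply Measurable.aemeasurable
          apply Measurable.ennreal_ofReal
          apply hm.comp
          fun_prop
      _ = ∫⁻ z, (∫⁻ p : Eucl n × Eucl n, ENNReal.ofReal (HD s g η p)) ∂(mollM φ) := by
          congr 1
          funext z
          have : (volume : Measure (Eucl n × Eucl n)).IsAddRightInvariant := by
            rw [Measure.volume_eq_prod]; infer_instance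
          exact lintegral_sub_right_eq_self (fun p => ENNReal.ofReal (HD s g η p)) (z, z)
      _ = _ := by simp
  have hfin : ∫⁻ p, ENNReal.ofReal (HD s g η p) = ENNReal.ofReal (∫ p, HD s g η p) :=
    (ofReal_integral_eq_lintegral_ofReal hi (Eventually.of_forall (fun p => HD_nonneg hg _ _))).symm
  have hInt1 : Integrable (HD s g (moll φ η)) := by
    refine ⟨hmm.aestronglyMeasurable, ?_⟩
    rw [hasFiniteIntegral_iff_ofReal (Eventually.of_forall (fun p => HD_nonneg hg _ _))]
    exact key.trans_lt (by rw [hfin]; exact ENNReal.ofReal_lt_top)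
  refine ⟨hInt1, ?_⟩
  rw [hfin, ← ofReal_integral_eq_lintegral_ofReal hInt1 (Eventually.of_forall (fun p => HD_nonneg hg _ _)),
    ENNReal.ofReal_le_ofReal_iff (integral_nonneg (fun p => HD_nonneg hg _ _))] at key
  exact key

end PartE

section PartF
variable {n : ℕ} {s : ℝ} {g : ℝ → ℝ} {pg qg : ℝ} {K : Eucl n → Eucl n → ℝ} {lam Lam : ℝ}

lemma HD_of_loc (hg : CondG g pg qg) {u : Eucl n → ℝ} {x₀ x₁ : Eucl n} {R r' : ℝ}
    (hu : MemWsGloc n s g u (ball x₀ R)) (hsub : closedBall x₁ r' ⊆ ball x₀ R) :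
    IntegrableOn (HD s g u) (ball x₁ r' ×ˢ ball x₁ r') := by
  obtain ⟨U, hU, hUs, hm, -, hi⟩ := hu (ball x₁ r') isOpen_ball isBounded_ball
    (closure_ball_subset_closedBall.trans hsub)
  have hVU : ball x₁ r' ⊆ U := subset_closure.trans hUs
  have h1 := (hi.mono_set (prod_mono hVU hVU)).const_mul (2 * 2 ^ qg)
  refine Integrable.mono' h1 (HD_meas hg hm).aestronglyMeasurable ?_
  filter_upwards with p
  rw [Real.norm_of_nonneg (HD_nonneg hg u p)]
  unfold HD
  rw [← HH_abs hg, DD_abs, ← mul_div_assoc]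
  gcongr
  exact HH_le_GG hg (by positivity)

lemma cgu_bound (hg : CondG g pg qg) {c u : Eucl n → ℝ} {x₀ : Eucl n} {R : ℝ}
    (hcc : ContinuousOn c (closure (ball x₀ R))) (huc : ContinuousOn u (closure (ball x₀ R))) :
    ∃ C, 0 ≤ C ∧ ∀ x ∈ ball x₀ R, |c x * g (u x)| ≤ C := by
  have hcomp : IsCompact (closure (ball x₀ R)) := isBounded_ball.isCompact_closure
  have hcont : ContinuousOn (fun x => c x * g (u x)) (closure (ball x₀ R)) :=
    hcc.mul ((cg_cont hg).comp_continuousOn huc)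
  obtain ⟨C, hC⟩ := hcomp.exists_bound_of_continuousOn hcont
  exact ⟨max C 0, le_max_right _ _, fun x hx => (hC x (subset_closure hx)).trans (le_max_left _ _)⟩

lemma cgu_meas (hg : CondG g pg qg) {c u : Eucl n → ℝ} {x₀ : Eucl n} {R : ℝ}
    (hcc : ContinuousOn c (closure (ball x₀ R))) (huc : ContinuousOn u (closure (ball x₀ R))) :
    AEStronglyMeasurable (fun x => c x * g (u x)) (volume.restrict (ball x₀ R)) := by
  have hcont : ContinuousOn (fun x => c x * g (u x)) (ball x₀ R) :=
    (hcc.mul ((cg_cont hg).comp_continuousOn huc)).mono subset_closure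
  exact hcont.aestronglyMeasurable measurableSet_ball

lemma test_ext (hg : CondG g pg qg) (hK : CondK n K lam Lam) (hs0 : 0 < s)
    {c u : Eucl n → ℝ} {x₀ x₁ : Eucl n} {R r r' : ℝ}
    (hcc : ContinuousOn c (closure (ball x₀ R))) (huc : ContinuousOn u (closure (ball x₀ R)))
    (hu : WeakSupersol n s g K c u (ball x₀ R)) (hr0 : 0 ≤ r) (hr : r < r')
    (hsub : closedBall x₁ r' ⊆ ball x₀ R)
    {η : Eucl n → ℝ} (hη : Continuous η) (hη0 : ∀ x, 0 ≤ η x) {M : ℝ} (hM : ∀ x, |η x| ≤ M)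
    (hz : ∀ x, x ∉ closedBall x₁ r → η x = 0) (hi : Integrable (HD s g η)) :
    Integrable (EI s g K u η) ∧ (∫ x in ball x₀ R, c x * g (u x) * η x) ≤ ∫ p, EI s g K u η p := by
  have hHu := HD_of_loc hg hu.1 hsub
  have hM0 : 0 ≤ M := (abs_nonneg _).trans (hM 0)
  have hL := Lam_pos hK
  have hum : Measurable u := hu.2.1.1
  set d := r' - r with hd
  have hd0 : 0 < d := by linarith
  set r₁ := r + d / 2 with hr₁
  have hr1 : r₁ < r' := by linarith
  have hr10 : 0 ≤ r₁ := by linarith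
  have hsub1 : closedBall x₁ r₁ ⊆ ball x₀ R := (closedBall_subset_closedBall hr1.le).trans hsub
  obtain ⟨Mu, hMu⟩ := (isCompact_closedBall x₁ r₁).exists_bound_of_continuousOn
    (huc.mono (hsub1.trans subset_closure))
  obtain ⟨D0, hD0, hdom⟩ := EI_dom hg hK hs0 hu.2.1 x₁ hr1 hr10 hMu hM0 hHu
  have hzr1 : ∀ x, x ∉ closedBall x₁ r₁ → η x = 0 := fun x hx =>
    hz x (fun h => hx (closedBall_subset_closedBall (by linarith) h))
  have hEI : Integrable (EI s g K u η) := by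
    refine (hD0.add (hi.const_mul Lam)).mono' (EI_meas hg hK hum hη.measurable).aestronglyMeasurable ?_
    filter_upwards with p using hdom η hM hzr1 p
  refine ⟨hEI, ?_⟩
  -- mollifiers
  have hpos : ∀ k : ℕ, 0 < d / (k + 2) := fun k => by positivity
  let φ : ℕ → ContDiffBump (0 : Eucl n) := fun k =>
    ⟨d / (k + 2) / 2, d / (k + 2), by have := hpos k; positivity, by have := hpos k; linarith⟩
  have hφ : ∀ k, (φ k).rOut = d / (k + 2) := fun k => rfl
  have hφle : ∀ k, (φ k).rOut ≤ d / 2 := by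
    intro k
    rw [hφ]
    have : (0:ℝ) ≤ k := Nat.cast_nonneg k
    apply div_le_div_of_nonneg_left hd0.le (by norm_num) (by linarith)
  have hφ0 : Tendsto (fun k => (φ k).rOut) atTop (𝓝 0) := by
    simp_rw [hφ]
    have h1 : Tendsto (fun k : ℕ => ((k:ℝ) + 2)) atTop atTop :=
      tendsto_atTop_add_const_right _ _ tendsto_natCast_atTop_atTop
    exact h1.const_div_atTop d
  have hlim : ∀ x, Tendsto (fun k => moll (φ k) η x) atTop (𝓝 (η x)) := by
    intro x
    simp_rw [moll_eq]
    exact ContDiffBump.convolution_tendsto_right_of_continuous hφ0 hη x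
  have hsupp : ∀ k x, x ∉ closedBall x₁ r₁ → moll (φ k) η x = 0 := by
    intro k x hx
    apply moll_supp (φ k) hz
    intro h
    exact hx (closedBall_subset_closedBall (by linarith [hφle k]) h)
  have hHDk := fun k => moll_HD (s := s) hg (φ k) hη hM hi
  have hEk : ∀ k p, |EI s g K u (moll (φ k) η) p| ≤ D0 p + Lam * HD s g (moll (φ k) η) p := fun k p =>
    hdom _ (moll_le (φ k) hM) (hsupp k) p
  have hlDD : ∀ p, Tendsto (fun k => DD s (moll (φ k) η) p) atTop (𝓝 (DD s η p)) := by
    intro p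
    exact ((hlim p.1).sub (hlim p.2)).div_const _
  obtain ⟨C, hC0, hC⟩ := cgu_bound hg hcc huc
  refine fatou_one_sided (F := fun k => EI s g K u (moll (φ k) η))
    (P := fun k p => Lam * HD s g (moll (φ k) η) p) (P0 := fun p => Lam * HD s g η p) (D := D0)
    (a := fun k => ∫ x in ball x₀ R, c x * g (u x) * moll (φ k) η x)
    hD0 (fun k => (hHDk k).1.const_mul Lam) (hi.const_mul Lam) ?_ hEI hEk ?_ ?_ ?_ ?_ ?_
  · intro k
    refine (hD0.add ((hHDk k).1.const_mul Lam)).mono'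
      (EI_meas hg hK hum (moll_contDiff (φ k) hη).continuous.measurable).aestronglyMeasurable ?_
    filter_upwards with p using hEk k p
  · intro p
    exact ((hlDD p).const_mul _).mul_const _
  · intro p
    exact ((((HH_cont hg).tendsto _).comp (hlDD p)).div_const _).const_mul _
  · intro k
    rw [integral_const_mul, integral_const_mul]
    exact mul_le_mul_of_nonneg_left (hHDk k).2 hL.le
  · apply tendsto_integral_of_dominated_convergence (fun _ => C * M)
    · intro k
      exact (cgu_meas hg hcc huc).mul (moll_contDiff (φ k) hη).continuous.aestronglyMeasurable
    · exact integrableOn_const measure_ball_lt_top.ne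
    · intro k
      rw [ae_restrict_iff' measurableSet_ball]
      filter_upwards with x hx
      rw [Real.norm_eq_abs, abs_mul]
      exact mul_le_mul (hC x hx) (moll_le (φ k) hM x) (abs_nonneg _) hC0
    · filter_upwards with x
      exact (hlim x).const_mul _
  · intro k
    rw [← energy_eq hg hK]
    have hts : tsupport (moll (φ k) η) ⊆ closedBall x₁ r₁ := by
      apply closure_minimal _ isClosed_closedBall
      intro x hx
      by_contra h
      exact hx (hsupp k x h)
    refine hu.2.2 (ball x₀ R) isOpen_ball isBounded_ball Subset.rfl _ ⟨moll_contDiff (φ k) hη, ?_, hts.trans hsub1⟩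
      (moll_nonneg (φ k) hη0)
    exact HasCompactSupport.of_support_subset_isCompact (isCompact_closedBall x₁ r₁)
      (subset_closure.trans hts)

end PartF

section PartG
variable {n : ℕ} {s : ℝ} {g : ℝ → ℝ} {pg qg : ℝ} {K : Eucl n → Eucl n → ℝ} {lam Lam : ℝ}

lemma pv_inner (hg : CondG g pg qg) (hK : CondK n K lam Lam) {w η : Eucl n → ℝ}
    (hw : Measurable w) (hηm : Measurable η) (hηi : Integrable η) {M : ℝ}
    (hM : ∀ x y, |w x - w y| ≤ M) (z : Eucl n) :
    Integrable (fun x => η x * (g (DD s w (x, x + z)) + g (DD s w (x, x - z)))) ∧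
    ∫ x, EI s g K w η (x, x + z) =
      ∫ x, η x * (g (DD s w (x, x + z)) + g (DD s w (x, x - z))) * (kk K z / ‖z‖ ^ s) := by
  have hb : ∀ x y : Eucl n, ‖x - y‖ = ‖z‖ → |g (DD s w (x, y))| ≤ g (M / ‖z‖ ^ s) := by
    intro x y h
    rw [cg_abs hg, DD_abs]
    apply cg_mono hg
    simp only [h]
    exact div_le_div_of_nonneg_right (hM x y) (by positivity)
  have hgm := (cg_cont hg).measurable
  have i1 : Integrable (fun x => η x * g (DD s w (x, x + z))) := by
    refine hηi.mul_bdd (c := g (M / ‖z‖ ^ s)) ?_ ?_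
    · exact (hgm.comp ((DD_meas hw).comp (by fun_prop))).aestronglyMeasurable
    · filter_upwards with x using hb _ _ (by simp)
  have i2 : Integrable (fun x => η x * g (DD s w (x, x - z))) := by
    refine hηi.mul_bdd (c := g (M / ‖z‖ ^ s)) ?_ ?_
    · exact (hgm.comp ((DD_meas hw).comp (by fun_prop))).aestronglyMeasurable
    · filter_upwards with x using hb _ _ (by simp)
  refine ⟨by simp only [mul_add]; exact i1.add i2, ?_⟩
  have i3 := i2.comp_add_right z
  have e3 := integral_add_right_eq_self (μ := (volume : Measure (Eucl n)))
    (fun x => η x * g (DD s w (x, x - z))) z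
  have eD : ∀ x, g (DD s w (x + z, x + z - z)) = - g (DD s w (x, x + z)) := by
    intro x
    rw [← hg.odd]
    congr 1
    simp only [DD, add_sub_cancel_right, add_sub_cancel_left, sub_add_cancel_left, norm_neg]
    ring
  rw [integral_mul_const]
  simp only [mul_add]
  rw [integral_add i1 i2, ← e3, ← integral_add i1 i3, ← integral_mul_const]
  congr 1
  funext x
  rw [eD]
  simp only [EI, DD, sub_add_cancel_left, norm_neg, kk_neg hK]
  ring

lemma pv_est (hg : CondG g pg qg) (hK : CondK n K lam Lam) {w η : Eucl n → ℝ}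
    (hw : Measurable w) (hηm : Measurable η) (hηi : Integrable η) (hη0 : ∀ x, 0 ≤ η x) {M : ℝ}
    (hM : ∀ x y, |w x - w y| ≤ M) (hE : Integrable (EI s g K w η)) {k : Eucl n → ℝ}
    (hk : Integrable k)
    (hb : ∀ x z, η x ≠ 0 →
      (g (DD s w (x, x + z)) + g (DD s w (x, x - z))) * (kk K z / ‖z‖ ^ s) ≤ k z) :
    ∫ p, EI s g K w η p ≤ (∫ z, k z) * ∫ x, η x := by
  have mp := measurePreserving_prod_add (volume : Measure (Eucl n)) (volume : Measure (Eucl n))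
  have me : MeasurableEmbedding (fun z : Eucl n × Eucl n => (z.1, z.1 + z.2)) :=
    (MeasurableEquiv.shearAddRight (Eucl n)).measurableEmbedding
  have hE' : Integrable (fun q : Eucl n × Eucl n => EI s g K w η (q.1, q.1 + q.2))
      (volume.prod volume) := (mp.integrable_comp_emb me).2 hE
  have e1 : ∫ p, EI s g K w η p = ∫ q : Eucl n × Eucl n, EI s g K w η (q.1, q.1 + q.2) ∂(volume.prod volume) :=
    (mp.integral_comp me _).symm
  rw [e1, integral_prod_symm _ hE', ← integral_mul_const]
  apply integral_mono hE'.integral_prod_right (hk.mul_const _)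
  intro z
  obtain ⟨h1, h2⟩ := pv_inner (s := s) hg hK hw hηm hηi hM z
  dsimp only
  rw [h2, ← integral_const_mul]
  apply integral_mono (h1.mul_const _) (hηi.const_mul _)
  intro x
  dsimp only
  by_cases h : η x = 0
  · simp [h]
  · have := mul_le_mul_of_nonneg_left (hb x z h) (hη0 x)
    linarith

/-- the barrier profile -/
def w1 (x₁ : Eucl n) (r : ℝ) (x : Eucl n) : ℝ := 1 - (min ‖x - x₁‖ (2 * r)) ^ 2 / r ^ 2

lemma w1_cont (x₁ : Eucl n) (r : ℝ) : Continuous (w1 x₁ r) := by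
  unfold w1; fun_prop

lemma w1_le (x₁ : Eucl n) (r : ℝ) (x) : w1 x₁ r x ≤ 1 := by
  unfold w1; have : 0 ≤ (min ‖x - x₁‖ (2 * r)) ^ 2 / r ^ 2 := by positivity
  linarith

lemma w1_ge (x₁ : Eucl n) {r : ℝ} (hr : 0 < r) (x) : -3 ≤ w1 x₁ r x := by
  unfold w1
  have h0 : 0 ≤ min ‖x - x₁‖ (2 * r) := by positivity
  have h1 : min ‖x - x₁‖ (2 * r) ≤ 2 * r := min_le_right _ _
  have : (min ‖x - x₁‖ (2 * r)) ^ 2 / r ^ 2 ≤ 4 := by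
    rw [div_le_iff₀ (by positivity)]; nlinarith
  linarith

lemma w1_self (x₁ : Eucl n) {r : ℝ} (hr : 0 < r) : w1 x₁ r x₁ = 1 := by
  unfold w1; simp [hr.le]

lemma w1_out (x₁ : Eucl n) {r : ℝ} (hr : 0 < r) {x} (hx : x ∉ closedBall x₁ r) : w1 x₁ r x ≤ 0 := by
  unfold w1
  rw [mem_closedBall, dist_eq_norm, not_le] at hx
  have h1 : r ≤ min ‖x - x₁‖ (2 * r) := le_min hx.le (by linarith)
  have : 1 ≤ (min ‖x - x₁‖ (2 * r)) ^ 2 / r ^ 2 := by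
    rw [le_div_iff₀ (by positivity)]; nlinarith
  linarith

lemma w1_far (x₁ : Eucl n) {r : ℝ} {x y} (hx : x ∉ closedBall x₁ (2 * r))
    (hy : y ∉ closedBall x₁ (2 * r)) : w1 x₁ r x = w1 x₁ r y := by
  unfold w1
  rw [mem_closedBall, dist_eq_norm, not_le] at hx hy
  rw [min_eq_right hx.le, min_eq_right hy.le]

lemma w1_lip (x₁ : Eucl n) {r : ℝ} (hr : 0 < r) (x y) : |w1 x₁ r x - w1 x₁ r y| ≤ 4 / r * ‖x - y‖ := by
  unfold w1
  set a := min ‖x - x₁‖ (2 * r)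
  set b := min ‖y - x₁‖ (2 * r)
  have ha0 : 0 ≤ a := by positivity
  have hb0 : 0 ≤ b := by positivity
  have ha : a ≤ 2 * r := min_le_right _ _
  have hb : b ≤ 2 * r := min_le_right _ _
  have hab : |b - a| ≤ ‖x - y‖ := by
    have h1 : |b - a| ≤ |‖y - x₁‖ - ‖x - x₁‖| := by
      have := abs_min_sub_min_le_max ‖y - x₁‖ (2 * r) ‖x - x₁‖ (2 * r)
      simpa using this
    have h2 := abs_norm_sub_norm_le (y - x₁) (x - x₁)
    rw [sub_sub_sub_cancel_right] at h2
    rw [norm_sub_rev x y]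
    linarith
  have e : 1 - a ^ 2 / r ^ 2 - (1 - b ^ 2 / r ^ 2) = (b + a) / r ^ 2 * (b - a) := by ring
  rw [e, abs_mul, abs_of_nonneg (by positivity)]
  have h4 : (b + a) / r ^ 2 ≤ 4 / r := by
    rw [div_le_div_iff₀ (by positivity) hr]; nlinarith
  exact mul_le_mul h4 hab (abs_nonneg _) (by positivity)

lemma w1_osc (x₁ : Eucl n) {r : ℝ} (hr : 0 < r) (x y) : |w1 x₁ r x - w1 x₁ r y| ≤ 4 := by
  have := w1_le x₁ r x; have := w1_le x₁ r y; have := w1_ge x₁ hr x; have := w1_ge x₁ hr y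
  rw [abs_le]; constructor <;> linarith

lemma w1_second (x₁ : Eucl n) {r : ℝ} (hr : 0 < r) {x z} (hx : x ∈ closedBall x₁ r) (hz : ‖z‖ ≤ r) :
    (w1 x₁ r x - w1 x₁ r (x + z)) + (w1 x₁ r x - w1 x₁ r (x - z)) = 2 * ‖z‖ ^ 2 / r ^ 2 := by
  unfold w1
  rw [mem_closedBall, dist_eq_norm] at hx
  have e1 : x + z - x₁ = (x - x₁) + z := by abel
  have e2 : x - z - x₁ = (x - x₁) - z := by abel
  have h1 : ‖(x - x₁) + z‖ ≤ 2 * r := (norm_add_le _ _).trans (by linarith)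
  have h2 : ‖(x - x₁) - z‖ ≤ 2 * r := (norm_sub_le _ _).trans (by linarith)
  rw [e1, e2, min_eq_left h1, min_eq_left h2, min_eq_left (by linarith : ‖x - x₁‖ ≤ 2 * r)]
  have := parallelogram_law_with_norm ℝ (x - x₁) z
  have h3 : ‖x - x₁ + z‖ ^ 2 + ‖x - x₁ - z‖ ^ 2 = 2 * (‖x - x₁‖ ^ 2 + ‖z‖ ^ 2) := by nlinarith
  field_simp
  linarith

/-- pointwise principal-value bound for the barrier -/
lemma barrier_pt (hg : CondG g pg qg) (hK : CondK n K lam Lam) (hs0 : 0 < s) (hs1 : s < 1)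
    (x₁ : Eucl n) {r δ : ℝ} (hr : 0 < r) (hr1 : r ≤ 1) (hδ : 0 < δ) (hδ1 : δ ≤ 1) {x : Eucl n}
    (hx : x ∈ closedBall x₁ r) (z : Eucl n) :
    (g (DD s (fun x => δ * w1 x₁ r x) (x, x + z)) + g (DD s (fun x => δ * w1 x₁ r x) (x, x - z)))
        * (kk K z / ‖z‖ ^ s) ≤
      δ * (g (2 * (4 / r)) / (4 / r) * (2 / r ^ 2) * Lam) * nearK n (2 - 2 * s) z
        + 2 * g (4 * δ / r ^ s) * Lam * tailK n s r z := by
  have hL := Lam_pos hK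
  have hT : 0 < 4 / r := by positivity
  have hgT := cg_nonneg hg (t := 2 * (4 / r)) (by positivity)
  have hgr := cg_nonneg hg (t := 4 * δ / r ^ s) (by positivity)
  have hN := nearK_nonneg (n := n) (2 - 2 * s) z
  have hTk := tailK_nonneg (n := n) (s := s) r z
  by_cases hz0 : z = 0
  · subst hz0
    have : (g (DD s (fun x => δ * w1 x₁ r x) (x, x + 0)) + g (DD s (fun x => δ * w1 x₁ r x) (x, x - 0)))
        * (kk K 0 / ‖(0 : Eucl n)‖ ^ s) = 0 := by simp [kk]
    rw [this]
    positivity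
  have hz : 0 < ‖z‖ := norm_pos_iff.2 hz0
  have hkk := kk_le hK z
  have hkk0 := kk_nonneg hK z
  set a := DD s (fun x => δ * w1 x₁ r x) (x, x + z) with ha
  set b := DD s (fun x => δ * w1 x₁ r x) (x, x - z) with hb
  have ea : a = δ * (w1 x₁ r x - w1 x₁ r (x + z)) / ‖z‖ ^ s := by
    simp only [ha, DD, sub_add_cancel_left, norm_neg]; ring
  have eb : b = δ * (w1 x₁ r x - w1 x₁ r (x - z)) / ‖z‖ ^ s := by
    simp only [hb, DD, sub_sub_cancel]; ring
  have hzs : 0 < ‖z‖ ^ s := by positivity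
  by_cases hzr : ‖z‖ ≤ r
  · have hz1 : ‖z‖ ≤ 1 := hzr.trans hr1
    have hzz : ‖z‖ ≤ ‖z‖ ^ s := by
      have := Real.rpow_le_rpow_of_exponent_ge hz hz1 hs1.le
      simpa using this
    have hbd : ∀ t : ℝ, |t| ≤ 4 / r * ‖z‖ → |δ * t / ‖z‖ ^ s| ≤ 4 / r := by
      intro t ht
      rw [abs_div, abs_mul, abs_of_pos hδ, abs_of_pos hzs, div_le_iff₀ hzs]
      calc δ * |t| ≤ 1 * (4 / r * ‖z‖) := by gcongr
        _ ≤ _ := by rw [one_mul]; gcongr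
    have h1 : |a| ≤ 4 / r := by
      rw [ea]; apply hbd
      simpa using w1_lip x₁ hr x (x + z)
    have h2 : |b| ≤ 4 / r := by
      rw [eb]; apply hbd
      simpa using w1_lip x₁ hr x (x - z)
    have h3 := cg_lip hg hT h1 (b := -b) (by rwa [abs_neg])
    rw [hg.odd, sub_neg_eq_add, sub_neg_eq_add] at h3
    have hab : a + b = δ * (2 * ‖z‖ ^ 2 / r ^ 2) / ‖z‖ ^ s := by
      rw [← w1_second x₁ hr hx hzr, ea, eb]; ring
    rw [hab, abs_of_nonneg (a := δ * (2 * ‖z‖ ^ 2 / r ^ 2) / ‖z‖ ^ s) (by positivity)] at h3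
    have h4 : g a + g b ≤ g (2 * (4 / r)) / (4 / r) * (δ * (2 * ‖z‖ ^ 2 / r ^ 2) / ‖z‖ ^ s) :=
      (le_abs_self _).trans h3
    have e2 : ‖z‖ ^ (2 - 2 * s) = ‖z‖ ^ 2 / ‖z‖ ^ s / ‖z‖ ^ s := by
      rw [show 2 - 2 * s = 2 - s - s by ring, Real.rpow_sub hz, Real.rpow_sub hz]
      norm_num
    have h5 : (g a + g b) * (kk K z / ‖z‖ ^ s) ≤
        δ * (g (2 * (4 / r)) / (4 / r) * (2 / r ^ 2) * Lam) * nearK n (2 - 2 * s) z := by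
      unfold nearK
      rw [if_pos hz1, e2]
      calc _ ≤ (g (2 * (4 / r)) / (4 / r) * (δ * (2 * ‖z‖ ^ 2 / r ^ 2) / ‖z‖ ^ s)) * ((Lam / ‖z‖ ^ n) / ‖z‖ ^ s) := by
            gcongr
        _ = _ := by ring
    have : 0 ≤ 2 * g (4 * δ / r ^ s) * Lam * tailK n s r z := by positivity
    linarith
  · have hzr' : r ≤ ‖z‖ := (not_le.1 hzr).le
    have hbd : ∀ t : ℝ, |t| ≤ 4 → g (δ * t / ‖z‖ ^ s) ≤ g (4 * δ / r ^ s) := by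
      intro t ht
      apply cg_mono hg
      have : t ≤ 4 := (le_abs_self t).trans ht
      calc δ * t / ‖z‖ ^ s ≤ δ * 4 / ‖z‖ ^ s := by gcongr
        _ ≤ δ * 4 / r ^ s := by gcongr
        _ = _ := by ring
    have h1 : g a ≤ g (4 * δ / r ^ s) := by rw [ea]; exact hbd _ (w1_osc x₁ hr _ _)
    have h2 : g b ≤ g (4 * δ / r ^ s) := by rw [eb]; exact hbd _ (w1_osc x₁ hr _ _)
    have h5 : (g a + g b) * (kk K z / ‖z‖ ^ s) ≤ 2 * g (4 * δ / r ^ s) * Lam * tailK n s r z := by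
      unfold tailK
      rw [if_pos hzr']
      calc _ ≤ (2 * g (4 * δ / r ^ s)) * ((Lam / ‖z‖ ^ n) / ‖z‖ ^ s) := by
            apply mul_le_mul (by linarith) (by gcongr) (by positivity) (by positivity)
        _ = _ := by field_simp
    have : 0 ≤ δ * (g (2 * (4 / r)) / (4 / r) * (2 / r ^ 2) * Lam) * nearK n (2 - 2 * s) z := by positivity
    linarith

end PartG

section PartH
variable {n : ℕ} {s : ℝ} {g : ℝ → ℝ} {pg qg : ℝ} {K : Eucl n → Eucl n → ℝ} {lam Lam : ℝ}

lemma comp_pt (hg : CondG g pg qg) (hK : CondK n K lam Lam) {w u : Eucl n → ℝ} (m : ℝ)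
    (p : Eucl n × Eucl n) :
    EI s g K u (fun x => max (w x - (u x + m)) 0) p ≤ EI s g K w (fun x => max (w x - (u x + m)) 0) p := by
  obtain ⟨x, y⟩ := p
  unfold EI
  apply mul_le_mul_of_nonneg_right _ (kk_nonneg hK _)
  set η : Eucl n → ℝ := fun x => max (w x - (u x + m)) 0 with hη
  have hzs : 0 ≤ ‖x - y‖ ^ s := by positivity
  have ex : η x = max (w x - (u x + m)) 0 := rfl
  have ey : η y = max (w y - (u y + m)) 0 := rfl
  rcases lt_trichotomy (η x) (η y) with h | h | h
  · have h1 : w x - w y ≤ u x - u y := by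
      rw [ex, ey] at h
      rcases le_or_gt (w y - (u y + m)) 0 with h2 | h2
      · rw [max_eq_right h2] at h
        exact absurd h (not_lt.2 (le_max_right _ _))
      · rw [max_eq_left h2.le] at h
        have := le_max_left (w x - (u x + m)) 0
        linarith
    apply mul_le_mul_of_nonpos_right
    · apply cg_mono hg
      exact div_le_div_of_nonneg_right h1 hzs
    · exact div_nonpos_of_nonpos_of_nonneg (by simpa using h.le) hzs
  · have : DD s η (x, y) = 0 := by simp [DD, h]
    rw [this]; simp
  · have h1 : u x - u y ≤ w x - w y := by
      rw [ex, ey] at h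
      rcases le_or_gt (w x - (u x + m)) 0 with h2 | h2
      · rw [max_eq_right h2] at h
        exact absurd h (not_lt.2 (le_max_right _ _))
      · rw [max_eq_left h2.le] at h
        have := le_max_left (w y - (u y + m)) 0
        linarith
    apply mul_le_mul_of_nonneg_right
    · apply cg_mono hg
      exact div_le_div_of_nonneg_right h1 hzs
    · exact div_nonneg (by simpa using h.le) hzs

lemma comp_far (hg : CondG g pg qg) (hK : CondK n K lam Lam) (hs0 : 0 < s) {w u η : Eucl n → ℝ} {θ N : ℝ}
    (hθ : 0 < θ) {x y : Eucl n} (hne : x ≠ y) (hN : ‖x - y‖ ≤ N) (hηx : 0 ≤ η x) (hηy : η y = 0)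
    (hw : w y ≤ w x) (hu : u x - u y ≤ -θ) :
    EI s g K u η (x, y) + g (θ / N ^ s) / N ^ s * (lam / N ^ n) * η x ≤ EI s g K w η (x, y) := by
  have hz : 0 < ‖x - y‖ := norm_pos_iff.2 (sub_ne_zero.2 hne)
  have hN0 : 0 < N := hz.trans_le hN
  have hl := hK.lam_pos
  have h1 : 0 ≤ g (DD s w (x, y)) := by
    apply cg_nonneg hg
    exact div_nonneg (by simpa using hw) (by positivity)
  have h2 : g (DD s u (x, y)) ≤ - g (θ / N ^ s) := by
    rw [← hg.odd]
    apply cg_mono hg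
    simp only [DD]
    calc (u x - u y) / ‖x - y‖ ^ s ≤ (-θ) / ‖x - y‖ ^ s := by gcongr
      _ = - (θ / ‖x - y‖ ^ s) := by ring
      _ ≤ - (θ / N ^ s) := by
        apply neg_le_neg; gcongr
  have h3 : η x / N ^ s ≤ DD s η (x, y) := by
    simp only [DD, hηy, sub_zero]
    gcongr
  have h4 : lam / N ^ n ≤ kk K (x - y) := by
    refine le_trans ?_ (kk_ge hK (sub_ne_zero.2 hne))
    gcongr
  have hgp := cg_nonneg hg (t := θ / N ^ s) (by positivity)
  have key : g (θ / N ^ s) * (η x / N ^ s) * (lam / N ^ n) ≤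
      (g (DD s w (x, y)) - g (DD s u (x, y))) * DD s η (x, y) * kk K (x - y) := by
    have h5 : g (θ / N ^ s) ≤ g (DD s w (x, y)) - g (DD s u (x, y)) := by linarith
    have h6 : 0 ≤ η x / N ^ s := by positivity
    have h7 : 0 ≤ lam / N ^ n := by positivity
    apply mul_le_mul _ h4 h7 _
    · exact mul_le_mul h5 h3 h6 (hgp.trans h5)
    · exact mul_nonneg (hgp.trans h5) (h6.trans h3)
  unfold EI
  have e : g (θ / N ^ s) / N ^ s * (lam / N ^ n) * η x = g (θ / N ^ s) * (η x / N ^ s) * (lam / N ^ n) := by ring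
  rw [e]
  simp only at key ⊢
  linarith

lemma core (hn : 1 ≤ n) (hs0 : 0 < s) (hs1 : s < 1) (hg : CondG g pg qg) (hK : CondK n K lam Lam)
    {x₀ : Eucl n} {R : ℝ} {c : Eucl n → ℝ} (hcc : ContinuousOn c (closure (ball x₀ R)))
    (hc0 : ∀ x ∈ closure (ball x₀ R), c x ≤ 0)
    {u : Eucl n → ℝ} (huc : ContinuousOn u (closure (ball x₀ R)))
    (hu : WeakSupersol n s g K c u (ball x₀ R)) {m : ℝ} (hm : 0 ≤ m) (hv : ∀ x, 0 ≤ u x + m)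
    {x₁ : Eucl n} (hx₁ : x₁ ∈ ball x₀ R) (hv1 : u x₁ + m = 0) {θ d N : ℝ} (hθ : 0 < θ) (hd : 0 < d)
    {A : Set (Eucl n)} (hAm : MeasurableSet A) (hA0 : volume A ≠ 0)
    (hA : ∀ y ∈ A, θ ≤ u y + m ∧ d ≤ ‖y - x₁‖ ∧ ‖y - x₁‖ ≤ N) : False := by
  have hL := Lam_pos hK
  have hl := hK.lam_pos
  have hum : Measurable u := hu.2.1.1
  -- geometry
  obtain ⟨r', hr'0, hsub⟩ : ∃ r' > 0, closedBall x₁ r' ⊆ ball x₀ R :=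
    nhds_basis_closedBall.mem_iff.1 (isOpen_ball.mem_nhds hx₁)
  obtain ⟨r, hr, hrr', hr1, hrd⟩ : ∃ r : ℝ, 0 < r ∧ r < r' ∧ r ≤ 1 ∧ r < d := by
    refine ⟨min (r' / 2) (min 1 (d / 2)), by positivity, ?_, ?_, ?_⟩
    · exact (min_le_left _ _).trans_lt (by linarith)
    · exact (min_le_right _ _).trans (min_le_left _ _)
    · exact ((min_le_right _ _).trans (min_le_right _ _)).trans_lt (by linarith)
  have hAfin : volume A ≠ ⊤ := by
    refine ((measure_mono (t := closedBall x₁ N) ?_).trans_lt measure_closedBall_lt_top).ne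
    intro y hy
    rw [mem_closedBall, dist_eq_norm]; exact (hA y hy).2.2
  have hN0 : 0 < N := by
    obtain ⟨y, hy⟩ := nonempty_of_measure_ne_zero hA0
    linarith [(hA y hy).2.1, (hA y hy).2.2]
  set N' := r + N with hN'
  have hN'0 : 0 < N' := by positivity
  set μA := volume.real A with hμA
  have hμA0 : 0 < μA := ENNReal.toReal_pos hA0 hAfin
  set κ := g (θ / 2 / N' ^ s) / N' ^ s * (lam / N' ^ n) with hκ
  have hκ0 : 0 < κ := by
    have := cg_pos hg (t := θ / 2 / N' ^ s) (by positivity)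
    positivity
  obtain ⟨C, hC⟩ := (isCompact_closedBall x₁ r').exists_bound_of_continuousOn
    (hcc.mono (hsub.trans subset_closure))
  have hC0 : 0 ≤ C := (norm_nonneg _).trans (hC x₁ (mem_closedBall_self hr'0.le))
  set C₁ := (g (2 * (4 / r)) / (4 / r) * (2 / r ^ 2) * Lam) * ∫ z, nearK n (2 - 2 * s) z with hC₁
  set C₂ := 2 * Lam * ∫ z, tailK n s r z with hC₂
  -- choice of delta
  obtain ⟨δ, hδ, hδ1, hδθ, hδF⟩ : ∃ δ : ℝ, 0 < δ ∧ δ ≤ 1 ∧ δ ≤ θ / 2 ∧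
      δ * C₁ + C₂ * g (4 * δ / r ^ s) + C * g δ < κ * μA := by
    have hgc := cg_cont hg
    have hF : Continuous (fun δ : ℝ => δ * C₁ + C₂ * g (4 * δ / r ^ s) + C * g δ) := by fun_prop
    have h0 : (fun δ : ℝ => δ * C₁ + C₂ * g (4 * δ / r ^ s) + C * g δ) 0 < κ * μA := by
      simp only [zero_mul, mul_zero, zero_div, hg.zero, add_zero]; positivity
    have h1 : ∀ᶠ δ in 𝓝[>] (0:ℝ), δ * C₁ + C₂ * g (4 * δ / r ^ s) + C * g δ < κ * μA :=
      (hF.continuousAt.eventually_lt_const h0).filter_mono nhdsWithin_le_nhds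
    have h2 : ∀ᶠ δ in 𝓝[>] (0:ℝ), δ ∈ Ioc 0 (min 1 (θ / 2)) :=
      Ioc_mem_nhdsGT (by positivity)
    obtain ⟨δ, h3, h4⟩ := (h1.and h2).exists
    exact ⟨δ, h4.1, h4.2.trans (min_le_left _ _), h4.2.trans (min_le_right _ _), h3⟩
  set w : Eucl n → ℝ := fun x => δ * w1 x₁ r x with hw
  have hwc : Continuous w := continuous_const.mul (w1_cont x₁ r)
  have hwle : ∀ x, w x ≤ δ := fun x => by
    have := mul_le_mul_of_nonneg_left (w1_le x₁ r x) hδ.le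
    simpa [hw] using this
  have hwout : ∀ x, x ∉ closedBall x₁ r → w x ≤ 0 := fun x hx =>
    mul_nonpos_of_nonneg_of_nonpos hδ.le (w1_out x₁ hr hx)
  set η : Eucl n → ℝ := fun x => max (w x - (u x + m)) 0 with hη
  have hη0 : ∀ x, 0 ≤ η x := fun x => le_max_right _ _
  have hηle : ∀ x, η x ≤ δ := fun x => max_le (by linarith [hwle x, hv x]) hδ.le
  have hηz : ∀ x, x ∉ closedBall x₁ r → η x = 0 := fun x hx =>
    max_eq_right (by linarith [hwout x hx, hv x])
  have hηpos : ∀ x, η x ≠ 0 → x ∈ closedBall x₁ r ∧ u x + m < w x := by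
    intro x hx
    refine ⟨by_contra fun h => hx (hηz x h), ?_⟩
    by_contra h
    exact hx (max_eq_right (by linarith))
  have hηM : ∀ x, |η x| ≤ δ := fun x => by rw [abs_of_nonneg (hη0 x)]; exact hηle x
  have hηc : Continuous η := by
    rw [continuous_iff_continuousAt]
    intro x
    by_cases hx : x ∈ ball x₀ R
    · have h1 : ContinuousAt u x := huc.continuousAt
        (mem_of_superset (isOpen_ball.mem_nhds hx) subset_closure)
      exact (hwc.continuousAt.sub (h1.add continuousAt_const)).max continuousAt_const
    · have hx' : x ∈ (closedBall x₁ r)ᶜ := fun h => hx (hsub (closedBall_subset_closedBall hrr'.le h))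
      have : η =ᶠ[𝓝 x] fun _ => 0 := by
        filter_upwards [isClosed_closedBall.isOpen_compl.mem_nhds hx'] with y hy using hηz y hy
      exact continuousAt_const.congr this.symm
  have hηcs : HasCompactSupport η := HasCompactSupport.intro (isCompact_closedBall x₁ r) hηz
  have hηi : Integrable η := hηc.integrable_of_hasCompactSupport hηcs
  have hηosc : ∀ x y, |η x - η y| ≤ δ := fun x y => by
    rw [abs_le]; constructor <;> linarith [hη0 x, hη0 y, hηle x, hηle y]
  have hηint : 0 < ∫ x, η x := by
    refine hηc.integral_pos_of_hasCompactSupport_nonneg_nonzero hηcs hη0 (x := x₁) ?_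
    have : η x₁ = δ := by
      simp only [hη, hw, hv1, w1_self x₁ hr]
      simp [hδ.le]
    rw [this]; exact hδ.ne'
  -- energies
  have hwHD : Integrable (HD s g w) := by
    refine HD_lip_int hn hg hs0 hs1 hwc.measurable (L := δ * (4 / r)) (M := δ * 4) (by positivity) ?_ ?_ x₁ (2 * r) ?_
    · intro x y
      have := w1_lip x₁ hr x y
      simp only [hw]
      rw [← mul_sub, abs_mul, abs_of_pos hδ, mul_assoc]
      gcongr
    · intro x y
      have := w1_osc x₁ hr x y
      simp only [hw]
      rw [← mul_sub, abs_mul, abs_of_pos hδ]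
      gcongr
    · intro x y hx hy
      simp only [hw]
      rw [w1_far x₁ hx hy]
  have huHD : IntegrableOn (HD s g u) (ball x₁ r' ×ˢ ball x₁ r') := HD_of_loc hg hu.1 hsub
  have hηHD : Integrable (HD s g η) := by
    refine HD_supp_int hg hs0 hηc.measurable hηosc x₁ hrr' hηz ?_
    refine Integrable.mono' ((hwHD.integrableOn.add huHD).const_mul (2 * 2 ^ qg))
      (HD_meas hg hηc.measurable).aestronglyMeasurable ?_
    filter_upwards with p
    rw [Real.norm_of_nonneg (HD_nonneg hg _ _)]
    have h1 : |DD s η p| ≤ |DD s w p| + |DD s u p| := by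
      rw [DD_abs, DD_abs, DD_abs, ← add_div]
      apply div_le_div_of_nonneg_right _ (by positivity)
      have h2 : |η p.1 - η p.2| ≤ |(w p.1 - (u p.1 + m)) - (w p.2 - (u p.2 + m))| := by
        have := abs_max_sub_max_le_max (w p.1 - (u p.1 + m)) 0 (w p.2 - (u p.2 + m)) 0
        simpa using this
      refine h2.trans ?_
      rw [show (w p.1 - (u p.1 + m)) - (w p.2 - (u p.2 + m)) = (w p.1 - w p.2) - (u p.1 - u p.2) by ring]
      exact abs_sub _ _
    have h2 := (HH_le_of_abs hg h1).trans (HH_add hg _ _)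
    rw [HH_abs hg, HH_abs hg] at h2
    unfold HD
    simp only [Pi.add_apply]
    calc _ ≤ (2 * 2 ^ qg * (HH g (DD s w p) + HH g (DD s u p))) / ‖p.1 - p.2‖ ^ n := by gcongr
      _ = _ := by ring
  obtain ⟨hEu, htest⟩ := test_ext hg hK hs0 hcc huc hu hr.le hrr' hsub hηc hη0 hηM hηz hηHD
  have hEw : Integrable (EI s g K w η) := by
    refine ((hwHD.add hηHD).const_mul Lam).mono' (EI_meas hg hK hwc.measurable hηc.measurable).aestronglyMeasurable ?_
    filter_upwards with p using EI_young hg hK w η p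
  -- principal value bound
  have hpv : ∫ p, EI s g K w η p ≤ (δ * C₁ + C₂ * g (4 * δ / r ^ s)) * ∫ x, η x := by
    have i1 := (nearK_int hn (a := 2 - 2 * s) (by linarith)).const_mul
      (δ * (g (2 * (4 / r)) / (4 / r) * (2 / r ^ 2) * Lam))
    have i2 := (tailK_int (n := n) hs0 hr).const_mul (2 * g (4 * δ / r ^ s) * Lam)
    have := pv_est hg hK hwc.measurable hηc.measurable hηi hη0 (M := δ * 4) ?_ hEw (i1.add i2) ?_
    · refine this.trans_eq ?_
      congr 1
      simp only [Pi.add_apply]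
      rw [integral_add i1 i2, integral_const_mul, integral_const_mul]
      ring
    · intro x y
      have := w1_osc x₁ hr x y
      simp only [hw]
      rw [← mul_sub, abs_mul, abs_of_pos hδ]
      gcongr
    · intro x z hx
      exact barrier_pt hg hK hs0 hs1 x₁ hr hr1 hδ hδ1 (hηpos x hx).1 z
  -- comparison
  have hcmp : (∫ p, EI s g K u η p) + κ * μA * ∫ x, η x ≤ ∫ p, EI s g K w η p := by
    have hIA : Integrable (A.indicator (fun _ : Eucl n => (1:ℝ))) := by
      rw [integrable_indicator_iff hAm]; exact integrableOn_const hAfin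
    have i3 : Integrable (fun p : Eucl n × Eucl n => η p.1 * A.indicator (fun _ => (1:ℝ)) p.2) :=
      hηi.mul_prod hIA
    have e3 : ∫ p : Eucl n × Eucl n, η p.1 * A.indicator (fun _ => (1:ℝ)) p.2 = (∫ x, η x) * μA := by
      have := integral_prod_mul (μ := (volume : Measure (Eucl n))) (ν := (volume : Measure (Eucl n)))
        η (A.indicator (fun _ => (1:ℝ)))
      rw [integral_indicator hAm, setIntegral_const, smul_eq_mul, mul_one] at this
      exact this
    have e4 : (∫ p, EI s g K u η p) + κ * μA * ∫ x, η x =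
        ∫ p : Eucl n × Eucl n, (EI s g K u η p + κ * (η p.1 * A.indicator (fun _ => (1:ℝ)) p.2)) := by
      rw [integral_add hEu (i3.const_mul κ), integral_const_mul, e3]; ring
    rw [e4]
    apply integral_mono (hEu.add (i3.const_mul κ)) hEw
    rintro ⟨x, y⟩
    change EI s g K u η (x, y) + κ * (η x * A.indicator (fun _ => (1:ℝ)) y) ≤ EI s g K w η (x, y)
    by_cases h : η x ≠ 0 ∧ y ∈ A
    · obtain ⟨hx, hy⟩ := h
      obtain ⟨hxb, hxw⟩ := hηpos x hx
      obtain ⟨hy1, hy2, hy3⟩ := hA y hy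
      have hyb : y ∉ closedBall x₁ r := by
        rw [mem_closedBall, dist_eq_norm]; linarith
      rw [indicator_of_mem hy, mul_one]
      have hxb' := hxb
      rw [mem_closedBall, dist_eq_norm] at hxb'
      refine comp_far hg hK hs0 (by positivity) (fun h => hyb (h ▸ hxb)) ?_ (hη0 x) (hηz y hyb) ?_ ?_
      · have := norm_sub_le_norm_sub_add_norm_sub x x₁ y
        rw [norm_sub_rev x₁ y] at this
        linarith
      · linarith [hwout y hyb, hv x]
      · linarith [hwle x]
    · have : η x * A.indicator (fun _ => (1:ℝ)) y = 0 := by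
        by_cases hx : η x = 0
        · simp [hx]
        · have : y ∉ A := fun hy => h ⟨hx, hy⟩
          simp [this]
      rw [this, mul_zero, add_zero]
      exact comp_pt hg hK m (x, y)
  -- right-hand side
  have hrhs : -(C * g δ) * ∫ x, η x ≤ ∫ x in ball x₀ R, c x * g (u x) * η x := by
    have hgd := cg_nonneg hg hδ.le
    obtain ⟨C', hC'0, hC'⟩ := cgu_bound hg hcc huc
    have e : ∫ x, η x = ∫ x in ball x₀ R, η x := by
      symm
      apply setIntegral_eq_integral_of_forall_compl_eq_zero
      intro x hx
      exact hηz x (fun h => hx (hsub (closedBall_subset_closedBall hrr'.le h)))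
    rw [e, ← integral_const_mul]
    apply integral_mono_ae (hηi.integrableOn.const_mul _)
    · refine (integrableOn_const (C := C' * δ) (measure_ball_lt_top (x := x₀) (r := R)).ne).mono'
        ((cgu_meas hg hcc huc).mul hηc.aestronglyMeasurable) ?_
      rw [ae_restrict_iff' measurableSet_ball]
      filter_upwards with x hx
      rw [Real.norm_eq_abs, abs_mul]
      exact mul_le_mul (hC' x hx) (hηM x) (abs_nonneg _) hC'0
    · refine Eventually.of_forall fun x => ?_
      dsimp only
      by_cases hx : η x = 0
      · simp [hx]
      · obtain ⟨hxb, hxw⟩ := hηpos x hx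
        apply mul_le_mul_of_nonneg_right _ (hη0 x)
        have hxb2 := closedBall_subset_closedBall hrr'.le hxb
        have h1 : c x ≤ 0 := hc0 x (subset_closure (hsub hxb2))
        have h2 : -C ≤ c x := by
          have := hC x hxb2
          rw [Real.norm_eq_abs] at this
          exact (abs_le.1 this).1
        have h3 : g (u x) ≤ g δ := cg_mono hg (by linarith [hwle x])
        nlinarith
  have : (κ * μA - (δ * C₁ + C₂ * g (4 * δ / r ^ s) + C * g δ)) * ∫ x, η x ≤ 0 := by
    nlinarith
  have h2 := mul_pos (sub_pos.2 hδF) hηint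
  linarith

end PartH

/-- Lemma 3.2, strong minimum principle on a ball: for a
continuous nonpositive `c` on the closed ball and a continuous weak
supersolution `u` of `𝓛u = c(x)g(|u|)u/|u|` in `B_R(x₀)` with `u ≥ 0` outside
the ball, either `u > 0` everywhere in `B_R(x₀)` or `u = 0` a.e. in `ℝⁿ`. -/
theorem strong_minimum_principle_ball
    (n : ℕ) (hn : 1 ≤ n) (s : ℝ) (hs0 : 0 < s) (hs1 : s < 1)
    (g : ℝ → ℝ) (pg qg : ℝ) (hg : CondG g pg qg)
    (K : Eucl n → Eucl n → ℝ) (lam Lam : ℝ) (hK : CondK n K lam Lam)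
    (x₀ : Eucl n) (R : ℝ) (hR : 0 < R)
    (c : Eucl n → ℝ) (hcc : ContinuousOn c (closure (ball x₀ R)))
    (hc0 : ∀ x ∈ closure (ball x₀ R), c x ≤ 0)
    (u : Eucl n → ℝ) (huc : ContinuousOn u (closure (ball x₀ R)))
    (hu : WeakSupersol n s g K c u (ball x₀ R))
    (hout : ∀ x ∉ ball x₀ R, 0 ≤ u x) :
    (∀ x ∈ ball x₀ R, 0 < u x) ∨ (∀ᵐ (x : Eucl n) ∂volume, u x = 0) := by
  by_cases hall : ∀ x ∈ ball x₀ R, 0 < u x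
  · exact Or.inl hall
  right
  push Not at hall
  obtain ⟨x₂, hx₂, hux₂⟩ := hall
  obtain ⟨x₃, hx₃, hmin⟩ := (isBounded_ball (x := x₀) (r := R)).isCompact_closure.exists_isMinOn
    ⟨x₂, subset_closure hx₂⟩ huc
  have hmin' : ∀ y ∈ ball x₀ R, u x₃ ≤ u y := fun y hy => hmin (subset_closure hy)
  obtain ⟨x₁, hx₁, hux₁, hle⟩ : ∃ x₁ ∈ ball x₀ R, u x₁ ≤ 0 ∧ ∀ y, u x₁ ≤ u y := by
    by_cases h3 : u x₃ < 0
    · refine ⟨x₃, by_contra fun h => absurd (hout x₃ h) (not_le.2 h3), h3.le, fun y => ?_⟩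
      by_cases hy : y ∈ ball x₀ R
      · exact hmin' y hy
      · exact h3.le.trans (hout y hy)
    · refine ⟨x₂, hx₂, hux₂, fun y => ?_⟩
      by_cases hy : y ∈ ball x₀ R
      · exact (hux₂.trans (not_lt.1 h3)).trans (hmin' y hy)
      · exact hux₂.trans (hout y hy)
  have hum : Measurable u := hu.2.1.1
  have : Nonempty (Fin n) := ⟨⟨0, hn⟩⟩
  have hnull : ∀ᵐ (x : Eucl n) ∂volume, u x + -u x₁ = 0 := by
    let A : ℕ → Set (Eucl n) := fun k =>
      {y | 1 / ((k:ℝ) + 1) ≤ u y + -u x₁ ∧ 1 / ((k:ℝ) + 1) ≤ ‖y - x₁‖ ∧ ‖y - x₁‖ ≤ k}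
    have hA : ∀ k, volume (A k) = 0 := by
      intro k
      by_contra hne
      refine core hn hs0 hs1 hg hK hcc hc0 huc hu (m := -u x₁) (by linarith)
        (fun x => by linarith [hle x]) hx₁ (by ring) (θ := 1 / ((k:ℝ) + 1)) (d := 1 / ((k:ℝ) + 1))
        (N := k) (by positivity) (by positivity) (A := A k) ?_ hne (fun y hy => hy)
      have h1 : Measurable fun y : Eucl n => ‖y - x₁‖ := by fun_prop
      exact (measurableSet_le measurable_const (hum.add_const _)).inter
        ((measurableSet_le measurable_const h1).inter (measurableSet_le h1 measurable_const))
    have hU : volume (({x₁} : Set (Eucl n)) ∪ ⋃ k, A k) = 0 :=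
      measure_union_null (measure_singleton x₁) (measure_iUnion_null hA)
    refine measure_mono_null ?_ hU
    intro y hy
    by_cases hyx : y = x₁
    · exact Or.inl hyx
    right
    have h1 : 0 < u y + -u x₁ := lt_of_le_of_ne (by linarith [hle y]) (Ne.symm hy)
    have h2 : 0 < ‖y - x₁‖ := norm_pos_iff.2 (sub_ne_zero.2 hyx)
    obtain ⟨k1, hk1⟩ := exists_nat_one_div_lt h1
    obtain ⟨k2, hk2⟩ := exists_nat_one_div_lt h2
    obtain ⟨k3, hk3⟩ := exists_nat_ge ‖y - x₁‖
    refine mem_iUnion.2 ⟨max k1 (max k2 k3), ?_, ?_, ?_⟩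
    · refine le_trans (one_div_le_one_div_of_le (by positivity) ?_) hk1.le
      have : (k1:ℝ) ≤ ((max k1 (max k2 k3) : ℕ) : ℝ) := by exact_mod_cast le_max_left _ _
      linarith
    · refine le_trans (one_div_le_one_div_of_le (by positivity) ?_) hk2.le
      have : (k2:ℝ) ≤ ((max k1 (max k2 k3) : ℕ) : ℝ) := by
        exact_mod_cast (le_max_left _ _).trans (le_max_right _ _)
      linarith
    · refine hk3.trans ?_
      exact_mod_cast (le_max_right _ _).trans (le_max_right _ _)
  have hm0 : u x₁ = 0 := by
    by_contra hne
    have hlt : u x₁ < 0 := lt_of_le_of_ne hux₁ hne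
    have h1 : volume (ball x₀ R)ᶜ = 0 := by
      refine measure_mono_null ?_ hnull
      intro y hy h
      have h2 := hout y hy
      have h3 : u y + -u x₁ = 0 := h
      linarith
    have h2 : volume (univ : Set (Eucl n)) = ⊤ := measure_univ_of_isAddLeftInvariant _
    rw [← union_compl_self (ball x₀ R)] at h2
    have h3 := measure_union_le (μ := (volume : Measure (Eucl n))) (ball x₀ R) (ball x₀ R)ᶜ
    rw [h2, h1, add_zero] at h3
    exact absurd h3 (not_le.2 measure_ball_lt_top)
  filter_upwards [hnull] with x hx
  rw [hm0] at hx
  simpa using hx
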